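/- arXiv:1511.00406 — 7 statements merged into one kernel-verified Lean document; each statement's English description precedes it below -/
import Mathlib

section
/- Let A and B be abelian categories with A having enough injectives, let F : A ⥤ B be an additive functor admitting an exact left adjoint L, and let a, b be objects of A such that the higher right derived functors vanish, (RᵗF)(a) = 0 and (RᵗF)(b) = 0 for all t > 0, and such that the counit morphisms L(F(a)) → a and L(F(b)) → b of the adjunction are isomorphisms. Then for every n ≥ 0 there is an isomorphism of abelian groups Extⁿ_A(a, b) ≅ Extⁿ_B(F(a), F(b)). -/
open CategoryTheory Limits

universe w w' v v' u u'

section Helpers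

open Abelian

lemma epi_of_exact_aux {C : Type u} [Category.{v} C] [Abelian C] {X Y Z W : C} (p : X ⟶ Z)
    (j : Z ⟶ Y) [Mono j] (e : X ⟶ Y) (he : p ≫ j = e) (d : Y ⟶ W) (hjd : j ≫ d = 0)
    (w : e ≫ d = 0) (ex : (ShortComplex.mk e d w).Exact) : Epi p := by
  subst he
  rw [epi_iff_surjective_up_to_refinements]
  intro T y
  rw [ShortComplex.exact_iff_exact_up_to_refinements] at ex
  obtain ⟨T', π, hπ, x, hx⟩ := ex (y ≫ j) (by simp [hjd])
  refine ⟨T', π, hπ, x, ?_⟩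
  rw [← cancel_mono j]
  simpa using hx

variable {A : Type u} [Category.{v} A] [Abelian A]
    {B : Type u'} [Category.{v'} B] [Abelian B]
    [HasExt.{w} A] [HasExt.{w'} B]
    {F : A ⥤ B} [F.Additive] {L : B ⥤ A}
    [PreservesFiniteLimits L] [PreservesFiniteColimits L]
    (adj : L ⊣ F)

/-- The comparison map `Extⁿ(M, F b) → Extⁿ(L M, b)`. -/
noncomputable def adjExt [L.Additive] (M : B) (b : A) (n : ℕ) :
    Ext.{w'} M (F.obj b) n →+ Ext.{w} (L.obj M) b n :=
  ((Ext.mk₀ (adj.counit.app b)).postcomp (L.obj M) (add_zero n)).comp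
    (L.mapExtAddHom M (F.obj b) n)

lemma adjExt_apply [L.Additive] (M : B) (b : A) (n : ℕ) (x : Ext.{w'} M (F.obj b) n) :
    (adjExt adj M b n : _ →+ Ext.{w} _ _ _) x =
      (x.mapExactFunctor L).comp (Ext.mk₀ (adj.counit.app b)) (add_zero n) := rfl

lemma adjExt_zero_bijective [L.Additive] (M : B) (b : A) :
    Function.Bijective (adjExt adj M b 0 : Ext.{w'} _ _ _ →+ Ext.{w} _ _ _) := by
  have h : ⇑(adjExt adj M b 0 : Ext.{w'} _ _ _ →+ Ext.{w} _ _ _) ∘ Ext.mk₀ =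
      Ext.mk₀ ∘ (adj.homEquiv M b).symm := by
    ext f : 1
    simp [adjExt_apply, Ext.mapExactFunctor_mk₀, Adjunction.homEquiv_counit]
  have h2 : Function.Bijective
      (⇑(adjExt adj M b 0 : Ext.{w'} _ _ _ →+ Ext.{w} _ _ _) ∘ Ext.mk₀) := by
    rw [h]
    exact (Ext.mk₀_bijective _ _).comp (Equiv.bijective _)
  exact (Function.Bijective.of_comp_iff _ (Ext.mk₀_bijective _ _)).1 h2

lemma adjExt_naturality [L.Additive] (M : B) {b c : A} (g : b ⟶ c) (n : ℕ)
    (x : Ext.{w'} M (F.obj b) n) :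
    (adjExt adj M c n : _ →+ Ext.{w} _ _ _) (x.comp (Ext.mk₀ (F.map g)) (add_zero n)) =
      ((adjExt adj M b n : _ →+ Ext.{w} _ _ _) x).comp (Ext.mk₀ g) (add_zero n) := by
  simp [adjExt_apply, Ext.mapExactFunctor_mk₀, Ext.mapExactFunctor_comp]

lemma adjExt_comp [L.Additive] (M : B) {b c : A} (n m : ℕ) (x : Ext.{w'} M (F.obj c) n)
    (y : Ext.{w'} (F.obj c) (F.obj b) m) (z : Ext.{w} c b m)
    (h : (y.mapExactFunctor L).comp (Ext.mk₀ (adj.counit.app b)) (add_zero m) =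
      (Ext.mk₀ (adj.counit.app c)).comp z (zero_add m)) :
    (adjExt adj M b (n + m) : _ →+ Ext.{w} _ _ _) (x.comp y rfl) =
      ((adjExt adj M c n : _ →+ Ext.{w} _ _ _) x).comp z rfl := by
  rw [adjExt_apply, adjExt_apply, Ext.mapExactFunctor_comp,
    Ext.comp_assoc_of_third_deg_zero, h, Ext.comp_assoc_of_second_deg_zero]

lemma adjExt_extClass [L.Additive] (M : B) {S : ShortComplex A} (hS : S.ShortExact)
    (hFS : (S.map F).ShortExact) (n : ℕ) (x : Ext.{w'} M (F.obj S.X₃) n) :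
    (adjExt adj M S.X₁ (n + 1) : _ →+ Ext.{w} _ _ _) (x.comp hFS.extClass rfl) =
      ((adjExt adj M S.X₃ n : _ →+ Ext.{w} _ _ _) x).comp hS.extClass rfl := by
  have nat := ShortComplex.ShortExact.extClass_naturality (hFS.map_of_exact L) hS
    { τ₁ := adj.counit.app S.X₁, τ₂ := adj.counit.app S.X₂, τ₃ := adj.counit.app S.X₃
      comm₁₂ := (adj.counit.naturality S.f).symm
      comm₂₃ := (adj.counit.naturality S.g).symm }
  refine adjExt_comp adj M n 1 x hFS.extClass hS.extClass ?_
  refine Eq.trans ?_ nat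
  exact congrArg (fun z ↦ Ext.comp z (Ext.mk₀ (adj.counit.app S.X₁)) (add_zero 1))
    (Ext.mapExactFunctor_extClass L hFS)

lemma adjExt_step [L.Additive] (M : B) {S : ShortComplex A} (hS : S.ShortExact)
    (hFS : (S.map F).ShortExact) [Injective S.X₂] (n : ℕ)
    (h : Function.Bijective (adjExt adj M S.X₃ n : Ext.{w'} _ _ _ →+ Ext.{w} _ _ _)) :
    Function.Bijective (adjExt adj M S.X₁ (n + 1) : Ext.{w'} _ _ _ →+ Ext.{w} _ _ _) := by
  have hFI : Injective (F.obj S.X₂) := adj.map_injective _ inferInstance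
  have hFI' : Injective (S.map F).X₂ := hFI
  constructor
  · rw [injective_iff_map_eq_zero]
    intro x hx
    obtain ⟨x', rfl⟩ := Ext.covariant_sequence_exact₁ _ hFS x (Ext.eq_zero_of_injective _) rfl
    have hx' := (adjExt_extClass adj M hS hFS n x').symm.trans hx
    obtain ⟨y, hy⟩ := Ext.covariant_sequence_exact₃ _ hS _ rfl hx'
    obtain ⟨z, rfl⟩ : ∃ z, (adjExt adj M S.X₂ n : Ext.{w'} _ _ _ →+ Ext.{w} _ _ _) z = y := by
      cases n with
      | zero => exact (adjExt_zero_bijective adj M S.X₂).2 y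
      | succ n => exact ⟨0, by rw [Ext.eq_zero_of_injective y, map_zero]⟩
    rw [← adjExt_naturality] at hy
    have := h.1 hy
    subst this
    exact (Ext.comp_assoc_of_second_deg_zero _ _ _ _).trans
      ((congrArg (fun t ↦ z.comp t rfl) hFS.comp_extClass).trans (Ext.comp_zero _ _ _ _ _))
  · intro y
    obtain ⟨y', rfl⟩ := Ext.covariant_sequence_exact₁ _ hS y (Ext.eq_zero_of_injective _) rfl
    obtain ⟨x', rfl⟩ := h.2 y'
    exact ⟨_, adjExt_extClass adj M hS hFS n x'⟩

lemma adjExt_bijective [L.Additive] [PreservesFiniteLimits F] (M : B) (K : CochainComplex A ℕ)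
    [∀ n, Injective (K.X n)]
    (hK : ∀ k, (ShortComplex.mk _ _ (K.d_comp_d k (k + 1) (k + 2))).Exact)
    (hFK : ∀ k, ((ShortComplex.mk _ _ (K.d_comp_d k (k + 1) (k + 2))).map F).Exact) (n : ℕ) :
    ∀ (k : ℕ) (Z : A) (i : Z ⟶ K.X k) [Mono i] (w : i ≫ K.d k (k + 1) = 0)
      (_ : (ShortComplex.mk i _ w).Exact),
      Function.Bijective (adjExt adj M Z n : Ext.{w'} _ _ _ →+ Ext.{w} _ _ _) := by
  induction n with
  | zero => intros; exact adjExt_zero_bijective adj M _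
  | succ n ih =>
    intro k Z i _ hw hex
    let j := kernel.ι (K.d (k + 1) (k + 2))
    let p : K.X k ⟶ kernel (K.d (k + 1) (k + 2)) := kernel.lift _ (K.d k (k + 1)) (by simp)
    have hpj : p ≫ j = K.d k (k + 1) := kernel.lift_ι _ _ _
    have hj : j ≫ K.d (k + 1) (k + 2) = 0 := kernel.condition _
    have hp : Epi p := epi_of_exact_aux p j _ hpj _ hj _ (hK k)
    have hip : i ≫ p = 0 := by
      rw [← cancel_mono j, Category.assoc, hpj, hw, zero_comp]
    have hFp : Epi (F.map p) := by
      refine epi_of_exact_aux (F.map p) (F.map j) _ (by rw [← F.map_comp, hpj]) _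
        (by rw [← F.map_comp, hj, F.map_zero]) _ (hFK k)
    have hSe : (ShortComplex.mk i p hip).Exact := by
      rw [ShortComplex.exact_iff_exact_up_to_refinements] at hex ⊢
      intro T x hx
      refine hex x ?_
      have hx' : x ≫ p = 0 := hx
      change x ≫ K.d k (k + 1) = 0
      exact (congrArg (fun t ↦ x ≫ t) hpj.symm).trans
        ((Category.assoc _ _ _).symm.trans (by rw [hx', zero_comp]))
    have hS : (ShortComplex.mk i p hip).ShortExact := { exact := hSe }
    have hFS : ((ShortComplex.mk i p hip).map F).ShortExact :=
      { exact := hSe.map_of_mono_of_preservesKernel F ‹_› inferInstance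
        mono_f := inferInstanceAs (Mono (F.map i))
        epi_g := hFp }
    refine adjExt_step adj M hS hFS n (ih (k + 1) _ j hj ?_)
    exact ShortComplex.exact_kernel _

end Helpers

/-- if `F : A ⥤ B` is an additive functor between abelian categories (`A` having
enough injectives) admitting an exact left adjoint `L`, and `a, b` are objects of `A` with
`(RᵗF)(a) = 0 = (RᵗF)(b)` for all `t > 0` and such that the counit maps `L(F(a)) → a` and
`L(F(b)) → b` are isomorphisms, then `Extⁿ_A(a, b) ≅ Extⁿ_B(F(a), F(b))` as abelian groups
for all `n ≥ 0`. -/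
theorem stmt0 {A : Type u} [Category.{v} A] [Abelian A] [EnoughInjectives A]
    {B : Type u'} [Category.{v'} B] [Abelian B]
    [HasExt.{w} A] [HasExt.{w'} B]
    (F : A ⥤ B) [F.Additive] (L : B ⥤ A)
    [PreservesFiniteLimits L] [PreservesFiniteColimits L]
    (adj : L ⊣ F) (a b : A)
    (ha : ∀ t : ℕ, 0 < t → IsZero ((F.rightDerived t).obj a))
    (hb : ∀ t : ℕ, 0 < t → IsZero ((F.rightDerived t).obj b))
    (ca : IsIso (adj.counit.app a)) (cb : IsIso (adj.counit.app b)) :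
    ∀ n : ℕ, Nonempty (Abelian.Ext.{w} a b n ≃+ Abelian.Ext.{w'} (F.obj a) (F.obj b) n) := by
  intro n
  have : PreservesLimitsOfSize.{0, 0} F := adj.rightAdjoint_preservesLimits
  have : PreservesFiniteLimits F := inferInstance
  have : L.Additive := Functor.additive_of_preserves_binary_products L
  let I := injectiveResolution b
  have hFK : ∀ k, ((ShortComplex.mk _ _
      (I.cocomplex.d_comp_d k (k + 1) (k + 2))).map F).Exact := by
    intro k
    have h0 := (hb (k + 1) (Nat.succ_pos k)).of_iso (I.isoRightDerivedObj F (k + 1)).symm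
    have h1 : ((F.mapHomologicalComplex _).obj I.cocomplex).ExactAt (k + 1) := by
      rw [HomologicalComplex.exactAt_iff_isZero_homology]
      exact h0
    exact (HomologicalComplex.exactAt_iff' _ k (k + 1) (k + 2) (by simp)
      (by simp only [CochainComplex.next]; rfl)).1 h1
  have hbij := adjExt_bijective.{w, w'} adj (F.obj a) I.cocomplex I.exact_succ hFK n 0 _
    (I.ι.f 0) I.ι_f_zero_comp_complex_d I.exact₀
  have e1 : Abelian.Ext.{w'} (F.obj a) (F.obj b) n ≃+ Abelian.Ext.{w} (L.obj (F.obj a)) b n :=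
    AddEquiv.ofBijective _ hbij
  let e : L.obj (F.obj a) ≅ a := asIso (adj.counit.app a)
  let e2 : Abelian.Ext.{w} a b n ≃+ Abelian.Ext.{w} (L.obj (F.obj a)) b n :=
    { toFun := fun x ↦ (Abelian.Ext.mk₀ e.hom).comp x (zero_add n)
      invFun := fun x ↦ (Abelian.Ext.mk₀ e.inv).comp x (zero_add n)
      left_inv := fun x ↦ by simp
      right_inv := fun x ↦ by simp
      map_add' := fun x y ↦ by simp }
  exact ⟨e2.trans e1.symm⟩
end

section
/- Let A be a ring, let M₀, M₁, …, M_k be left A-modules, and let a₀, a₁, …, a_k be positive integers. Set Y := M₀ ⊕ M₁ ⊕ ⋯ ⊕ M_k and Z := M₀^{⊕a₀} ⊕ M₁^{⊕a₁} ⊕ ⋯ ⊕ M_k^{⊕a_k}. Then the rings End_A(Y) and End_A(Z) are Morita equivalent, i.e. their categories of left modules are equivalent; moreover the quotient rings End_A(Y)/[M₀] and End_A(Z)/[M₀] are Morita equivalent. -/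
open CategoryTheory

/-- The set of endomorphisms of `E` that factor through a finite direct sum of copies of `N`. -/
def factorsThroughSet (A : Type*) [Ring A] (N E : Type*) [AddCommGroup N] [AddCommGroup E]
    [Module A N] [Module A E] : Set (Module.End A E) :=
  {f | ∃ (k : ℕ) (g : E →ₗ[A] (Fin k → N)) (h : (Fin k → N) →ₗ[A] E), f = h.comp g}

/-- The two-sided ideal `[N]` of `End_A(E)` of endomorphisms factoring through finite
direct sums of copies of `N`. -/
def factorIdeal (A : Type*) [Ring A] (N E : Type*) [AddCommGroup N] [AddCommGroup E]
    [Module A N] [Module A E] : TwoSidedIdeal (Module.End A E) :=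
  TwoSidedIdeal.span (factorsThroughSet A N E)

/-- Two rings are Morita equivalent if their categories of left modules are equivalent. -/
def MoritaEquivalent (R S : Type*) [Ring R] [Ring S] : Prop :=
  Nonempty (ModuleCat.{max u_1 u_2} R ≌ ModuleCat.{max u_1 u_2} S)

namespace CornerMorita

universe u

variable {R S : Type u} [Ring R] [Ring S] (φ : R →ₙ+* S)

/-- The corner `pN` where `p = φ 1`. -/
def corner (N : Type u) [AddCommGroup N] [Module S N] : AddSubgroup N where
  carrier := {n | φ 1 • n = n}
  zero_mem' := smul_zero _
  add_mem' := by
    intro a b ha hb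
    simp only [Set.mem_ofPred_eq] at *
    rw [smul_add, ha, hb]
  neg_mem' := by
    intro a ha
    simp only [Set.mem_ofPred_eq] at *
    rw [smul_neg, ha]

theorem mem_corner {N : Type u} [AddCommGroup N] [Module S N] {n : N} :
    n ∈ corner φ N ↔ φ 1 • n = n := Iff.rfl

theorem smul_mem_corner {N : Type u} [AddCommGroup N] [Module S N] (r : R) (n : N) :
    φ r • n ∈ corner φ N := by
  rw [mem_corner, smul_smul, ← map_mul, one_mul]

instance cornerModule (N : Type u) [AddCommGroup N] [Module S N] : Module R (corner φ N) where
  smul r n := ⟨φ r • (n : N), smul_mem_corner φ r (n : N)⟩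
  one_smul n := Subtype.ext n.2
  mul_smul r r' n := Subtype.ext (by
    change φ (r * r') • (n : N) = φ r • φ r' • (n : N)
    rw [map_mul, mul_smul])
  smul_zero r := Subtype.ext (smul_zero (φ r))
  smul_add r n n' := Subtype.ext (smul_add (φ r) (n : N) n')
  add_smul r r' n := Subtype.ext (by
    change φ (r + r') • (n : N) = φ r • (n : N) + φ r' • (n : N)
    rw [map_add, add_smul])
  zero_smul n := Subtype.ext (by
    change φ 0 • (n : N) = 0
    rw [map_zero, zero_smul])

theorem coe_smul {N : Type u} [AddCommGroup N] [Module S N] (r : R) (n : corner φ N) :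
    ((r • n : corner φ N) : N) = φ r • (n : N) := rfl

/-- The map on corners induced by a linear map. -/
def cornerMap {N N' : Type u} [AddCommGroup N] [Module S N] [AddCommGroup N'] [Module S N']
    (f : N →ₗ[S] N') : corner φ N →ₗ[R] corner φ N' where
  toFun n := ⟨f n, by rw [mem_corner, ← map_smul, (mem_corner φ).1 n.2]⟩
  map_add' n n' := Subtype.ext (map_add f (n : N) n')
  map_smul' r n := Subtype.ext (map_smul f (φ r) (n : N))

/-- The corner functor. -/
def cornerFunctor : ModuleCat.{u} S ⥤ ModuleCat.{u} R where
  obj N := ModuleCat.of R (corner φ N)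
  map f := ModuleCat.ofHom (cornerMap φ f.hom)
  map_id _ := rfl
  map_comp _ _ := rfl

/-- The coinduced module. -/
def coind (M : Type u) [AddCommGroup M] [Module R M] : AddSubgroup (S →+ M) where
  carrier := {f | ∀ r s, f (φ r * s) = r • f s}
  zero_mem' := by intro r s; simp
  add_mem' := by
    intro a b ha hb r s
    simp [ha r s, hb r s]
  neg_mem' := by
    intro a ha r s
    simp [ha r s]

instance coindModule (M : Type u) [AddCommGroup M] [Module R M] : Module S (coind φ M) where
  smul t f := ⟨(f : S →+ M).comp (AddMonoidHom.mulRight t), by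
    intro r s
    simpa [mul_assoc] using f.2 r (s * t)⟩
  one_smul f := by
    refine Subtype.ext (AddMonoidHom.ext fun s => ?_)
    change (f : S →+ M) (s * 1) = _
    rw [mul_one]
  mul_smul t t' f := by
    refine Subtype.ext (AddMonoidHom.ext fun s => ?_)
    change (f : S →+ M) (s * (t * t')) = (f : S →+ M) (s * t * t')
    rw [mul_assoc]
  smul_zero t := rfl
  smul_add t f f' := rfl
  add_smul t t' f := by
    refine Subtype.ext (AddMonoidHom.ext fun s => ?_)
    change (f : S →+ M) (s * (t + t')) = (f : S →+ M) (s * t) + (f : S →+ M) (s * t')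
    rw [mul_add, map_add]
  zero_smul f := by
    refine Subtype.ext (AddMonoidHom.ext fun s => ?_)
    change (f : S →+ M) (s * 0) = 0
    rw [mul_zero, map_zero]

theorem coind_smul_apply {M : Type u} [AddCommGroup M] [Module R M] (t : S) (f : coind φ M)
    (s : S) : ((t • f : coind φ M) : S →+ M) s = (f : S →+ M) (s * t) := rfl

theorem map_one_mul (r : R) : φ 1 * φ r = φ r := by rw [← map_mul, one_mul]
theorem map_mul_one (r : R) : φ r * φ 1 = φ r := by rw [← map_mul, mul_one]

/-- The corner of the coinduced module is the original module. -/
noncomputable def coindEquiv (hinj : Function.Injective φ)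
    (hsurj : ∀ s, ∃ r, φ r = φ 1 * s * φ 1)
    (M : Type u) [AddCommGroup M] [Module R M] :
    corner φ (coind φ M) ≃ₗ[R] M := by
  refine LinearEquiv.ofBijective
    ({ toFun := fun f => ((f : coind φ M) : S →+ M) (φ 1)
       map_add' := fun f g => rfl
       map_smul' := fun r f => ?_ } : corner φ (coind φ M) →ₗ[R] M) ⟨?_, ?_⟩
  · change ((f : coind φ M) : S →+ M) (φ 1 * φ r) = r • ((f : coind φ M) : S →+ M) (φ 1)
    rw [map_one_mul, ← map_mul_one]
    exact (f : coind φ M).2 r (φ 1)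
  · have key : ∀ (f : corner φ (coind φ M)) (s : S) (r : R), φ r = φ 1 * s * φ 1 →
        ((f : coind φ M) : S →+ M) s = r • ((f : coind φ M) : S →+ M) (φ 1) := by
      intro f s r hr
      have h1 : ((f : coind φ M) : S →+ M) (s * φ 1) = ((f : coind φ M) : S →+ M) s := by
        rw [← coind_smul_apply, (mem_corner φ).1 f.2]
      have h2 := (f : coind φ M).2 1 (s * φ 1)
      rw [one_smul, ← mul_assoc, ← hr, ← map_mul_one, (f : coind φ M).2 r (φ 1)] at h2
      rw [h2, h1]
    intro f g hfg
    refine Subtype.ext (Subtype.ext (AddMonoidHom.ext fun s => ?_))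
    obtain ⟨r, hr⟩ := hsurj s
    rw [key f s r hr, key g s r hr]
    exact congrArg (r • ·) hfg
  · intro m
    choose ψ hψ using hsurj
    let F : S →+ M :=
      { toFun := fun s => ψ s • m
        map_zero' := by
          have : ψ 0 = 0 := hinj (by rw [hψ]; simp)
          rw [this, zero_smul]
        map_add' := fun s t => by
          have : ψ (s + t) = ψ s + ψ t := hinj (by
            rw [map_add, hψ, hψ, hψ, mul_add, add_mul])
          rw [this, add_smul] }
    have hF : F ∈ coind φ M := by
      intro r s
      change ψ (φ r * s) • m = r • ψ s • m
      have : ψ (φ r * s) = r * ψ s := hinj (by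
        rw [map_mul, hψ, hψ, ← mul_assoc, ← mul_assoc, ← mul_assoc, map_one_mul, map_mul_one])
      rw [this, mul_smul]
    have hF' : (⟨F, hF⟩ : coind φ M) ∈ corner φ (coind φ M) := by
      rw [mem_corner]
      refine Subtype.ext (AddMonoidHom.ext fun s => ?_)
      change ψ (s * φ 1) • m = ψ s • m
      have : ψ (s * φ 1) = ψ s := hinj (by
        rw [hψ, hψ, mul_assoc, mul_assoc s, map_mul_one, mul_assoc])
      rw [this]
    refine ⟨⟨⟨F, hF⟩, hF'⟩, ?_⟩
    change ψ (φ 1) • m = m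
    have : ψ (φ 1) = 1 := hinj (by rw [hψ, map_mul_one, map_mul_one])
    rw [this, one_smul]

theorem sum_smul_eq {J : Type} [Fintype J] {x y : J → S} (hxy : ∑ j, x j * φ 1 * y j = 1)
    {N : Type u} [AddCommGroup N] [Module S N] (n : N) :
    ∑ j, x j • φ 1 • y j • n = n := by
  simp_rw [smul_smul, ← Finset.sum_smul]
  simp_rw [← mul_assoc]
  rw [hxy, one_smul]

/-- The extension of a map between corners. -/
def extend {J : Type} [Fintype J] {x y : J → S} (hxy : ∑ j, x j * φ 1 * y j = 1)
    (hsurj : ∀ s, ∃ r, φ r = φ 1 * s * φ 1)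
    {N N' : Type u} [AddCommGroup N] [Module S N] [AddCommGroup N'] [Module S N']
    (g : corner φ N →ₗ[R] corner φ N') : N →ₗ[S] N' where
  toFun n := ∑ j, x j • (g ⟨φ 1 • y j • n, smul_mem_corner φ 1 _⟩ : N')
  map_add' n n' := by
    rw [← Finset.sum_add_distrib]
    refine Finset.sum_congr rfl fun j _ => ?_
    rw [← smul_add, ← AddSubgroup.coe_add, ← map_add]
    congr 3
    refine Subtype.ext ?_
    simp [smul_add]
  map_smul' s n := by
    choose ψ hψ using hsurj
    have h1 : ∀ j, (g ⟨φ 1 • y j • s • n, smul_mem_corner φ 1 _⟩ : N') =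
        ∑ i, (φ 1 * y j * s * x i * φ 1) • (g ⟨φ 1 • y i • n, smul_mem_corner φ 1 _⟩ : N') := by
      intro j
      have : (⟨φ 1 • y j • s • n, smul_mem_corner φ 1 _⟩ : corner φ N) =
          ∑ i, ψ (y j * s * x i) • (⟨φ 1 • y i • n, smul_mem_corner φ 1 _⟩ : corner φ N) := by
        refine Subtype.ext ?_
        rw [AddSubgroup.val_finsetSum]
        simp_rw [coe_smul, hψ]
        conv_lhs => rw [← sum_smul_eq φ hxy n]
        simp_rw [Finset.smul_sum, smul_smul]
        refine Finset.sum_congr rfl fun i _ => ?_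
        congr 1
        simp only [mul_assoc]
        rw [← mul_assoc (φ 1) (φ 1), map_one_mul]
      rw [this, map_sum, AddSubgroup.val_finsetSum]
      refine Finset.sum_congr rfl fun i _ => ?_
      rw [map_smul, coe_smul, hψ]
      simp only [mul_assoc]
    simp_rw [h1, Finset.smul_sum]
    rw [Finset.sum_comm]
    refine Finset.sum_congr rfl fun i _ => ?_
    set m := g ⟨φ 1 • y i • n, smul_mem_corner φ 1 _⟩ with hm
    have h2 := sum_smul_eq φ hxy (s • x i • (m : N'))
    rw [RingHom.id_apply, ← h2]
    refine Finset.sum_congr rfl fun j _ => ?_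
    simp only [mul_smul]
    rw [(mem_corner φ).1 m.2]

theorem isEquivalence (hinj : Function.Injective φ)
    (hsurj : ∀ s, ∃ r, φ r = φ 1 * s * φ 1)
    {J : Type} [Fintype J] {x y : J → S} (hxy : ∑ j, x j * φ 1 * y j = 1) :
    (cornerFunctor φ).IsEquivalence where
  faithful := ⟨by
    intro N N' f f' h
    have h' : ∀ n : corner φ N, f.hom (n : N) = f'.hom (n : N) := fun n =>
      congrArg Subtype.val (LinearMap.congr_fun (congrArg ModuleCat.Hom.hom h) n)
    refine ModuleCat.hom_ext (LinearMap.ext fun n => ?_)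
    rw [← sum_smul_eq φ hxy n, map_sum, map_sum]
    refine Finset.sum_congr rfl fun j _ => ?_
    rw [map_smul f.hom, map_smul f'.hom, h' ⟨φ 1 • y j • n, smul_mem_corner φ 1 _⟩]⟩
  full := ⟨by
    intro N N' g
    let g' : corner φ N →ₗ[R] corner φ N' := g.hom
    refine ⟨ModuleCat.ofHom (extend φ hxy hsurj g'), ?_⟩
    refine ModuleCat.hom_ext (LinearMap.ext fun (n : corner φ N) => Subtype.ext ?_)
    change ∑ j, x j • (g'
      ⟨φ 1 • y j • (n : N), smul_mem_corner φ 1 _⟩ : N') = _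
    have hh := sum_smul_eq φ hxy (g' n : N')
    refine Eq.trans ?_ hh
    refine Finset.sum_congr rfl fun j _ => ?_
    congr 1
    obtain ⟨r, hr⟩ := hsurj (y j)
    have : (⟨φ 1 • y j • (n : N), smul_mem_corner φ 1 _⟩ : corner φ N) = r • n := by
      refine Subtype.ext ?_
      rw [coe_smul, hr, mul_smul, mul_smul, (mem_corner φ).1 n.2]
    rw [this, map_smul, coe_smul, hr, mul_smul, mul_smul,
      (mem_corner φ).1 (g' n).2]⟩
  essSurj := ⟨fun M => ⟨ModuleCat.of S (coind φ M),
    ⟨(coindEquiv φ hinj hsurj M).toModuleIso⟩⟩⟩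

theorem morita (hinj : Function.Injective φ)
    (hsurj : ∀ s, ∃ r, φ r = φ 1 * s * φ 1)
    {J : Type} [Fintype J] {x y : J → S} (hxy : ∑ j, x j * φ 1 * y j = 1) :
    MoritaEquivalent R S := by
  have := isEquivalence φ hinj hsurj hxy
  exact ⟨(cornerFunctor φ).asEquivalence.symm⟩

/-- Variant for quotients on both sides. -/
theorem morita_quotient {R' S' : Type u} [Ring R'] [Ring S']
    (hsurj : ∀ s, ∃ r, φ r = φ 1 * s * φ 1)
    {J : Type} [Fintype J] {x y : J → S} (hxy : ∑ j, x j * φ 1 * y j = 1)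
    (q : R →+* R') (hq : Function.Surjective q) (p : S →+* S') (hp : Function.Surjective p)
    (hker : ∀ r, q r = 0 ↔ p (φ r) = 0) : MoritaEquivalent R' S' := by
  have hwd : ∀ r r', q r = q r' ↔ p (φ r) = p (φ r') := by
    intro r r'
    rw [← sub_eq_zero, ← map_sub, hker, map_sub, map_sub, sub_eq_zero]
  choose σ hσ using hq
  have hk : ∀ r, p (φ (σ (q r))) = p (φ r) := fun r => (hwd _ _).1 (hσ _)
  let ψ : R' →ₙ+* S' :=
    { toFun := fun r => p (φ (σ r))
      map_mul' := fun r r' => by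
        rw [← map_mul, ← map_mul, ← hwd]; simp [hσ]
      map_zero' := by rw [← hker, hσ]
      map_add' := fun r r' => by
        rw [← map_add, ← map_add, ← hwd]; simp [hσ] }
  have hψ : ∀ r, ψ (q r) = p (φ r) := hk
  have hψ1 : ψ 1 = p (φ 1) := by rw [← hψ, map_one q]
  refine morita ψ ?_ ?_ (x := fun j => p (x j)) (y := fun j => p (y j)) ?_
  · intro r r' h
    rw [← hσ r, ← hσ r', hwd]
    exact h
  · intro s
    obtain ⟨s, rfl⟩ := hp s
    obtain ⟨r, hr⟩ := hsurj s
    exact ⟨q r, by rw [hψ, hr, hψ1, map_mul, map_mul]⟩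
  · rw [hψ1, ← map_one p, ← hxy, map_sum]
    simp

end CornerMorita

section Factor

variable (A : Type*) [Ring A] (N E : Type*) [AddCommGroup N] [AddCommGroup E]
    [Module A N] [Module A E]

theorem factorsThrough_zero : (0 : Module.End A E) ∈ factorsThroughSet A N E :=
  ⟨0, 0, 0, by simp⟩

theorem factorsThrough_add {f f' : Module.End A E} (hf : f ∈ factorsThroughSet A N E)
    (hf' : f' ∈ factorsThroughSet A N E) : f + f' ∈ factorsThroughSet A N E := by
  obtain ⟨k, g, h, rfl⟩ := hf
  obtain ⟨l, g', h', rfl⟩ := hf'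
  let i1 : (Fin (k + l) → N) →ₗ[A] (Fin k → N) := LinearMap.funLeft A N (Fin.castAdd l)
  let i2 : (Fin (k + l) → N) →ₗ[A] (Fin l → N) := LinearMap.funLeft A N (Fin.natAdd k)
  let G : E →ₗ[A] (Fin (k + l) → N) := LinearMap.pi
    (Fin.addCases (fun i => (LinearMap.proj i).comp g) (fun i => (LinearMap.proj i).comp g'))
  refine ⟨k + l, G, h.comp i1 + h'.comp i2, ?_⟩
  have e1 : i1.comp G = g := by
    ext e i; simp [i1, G, LinearMap.funLeft]
  have e2 : i2.comp G = g' := by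
    ext e i; simp [i2, G, LinearMap.funLeft]
  rw [LinearMap.add_comp, LinearMap.comp_assoc, LinearMap.comp_assoc, e1, e2]

theorem mem_factorIdeal {f : Module.End A E} :
    f ∈ factorIdeal A N E ↔ f ∈ factorsThroughSet A N E := by
  constructor
  · intro hf
    let I : TwoSidedIdeal (Module.End A E) := TwoSidedIdeal.mk' (factorsThroughSet A N E)
      (factorsThrough_zero A N E) (factorsThrough_add A N E)
      (by
        rintro _ ⟨k, g, h, rfl⟩
        exact ⟨k, g, -h, by rw [LinearMap.neg_comp]⟩)
      (by
        rintro x _ ⟨k, g, h, rfl⟩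
        exact ⟨k, g, x.comp h, rfl⟩)
      (by
        rintro _ y ⟨k, g, h, rfl⟩
        exact ⟨k, g.comp y, h, rfl⟩)
    have hI : ∀ x, x ∈ I ↔ x ∈ factorsThroughSet A N E := fun x => by
      simp [I, TwoSidedIdeal.mem_mk']
    have hle : factorIdeal A N E ≤ I :=
      TwoSidedIdeal.span_le.2 fun x hx => (hI x).2 hx
    exact (hI f).1 (hle hf)
  · intro hf
    exact TwoSidedIdeal.subset_span hf

end Factor

/-- with `Y = M₀ ⊕ ⋯ ⊕ M_k` and `Z = M₀^{a₀} ⊕ ⋯ ⊕ M_k^{a_k}` (all `aᵢ ≥ 1`),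
the rings `End_A(Y)` and `End_A(Z)` are Morita equivalent, and so are the quotients
`End_A(Y)/[M₀]` and `End_A(Z)/[M₀]`. -/
theorem stmt1 (A : Type*) [Ring A] (k : ℕ) (M : Fin (k + 1) → Type*)
    [∀ i, AddCommGroup (M i)] [∀ i, Module A (M i)]
    (a : Fin (k + 1) → ℕ) (ha : ∀ i, 0 < a i) :
    MoritaEquivalent (Module.End A (∀ i, M i)) (Module.End A (∀ i, Fin (a i) → M i)) ∧
    MoritaEquivalent
      ((factorIdeal A (M 0) (∀ i, M i)).ringCon.Quotient)
      ((factorIdeal A (M 0) (∀ i, Fin (a i) → M i)).ringCon.Quotient) := by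
  let ι : (∀ i, M i) →ₗ[A] (∀ i, Fin (a i) → M i) :=
    LinearMap.pi fun i => (LinearMap.single A (fun _ : Fin (a i) => M i) ⟨0, ha i⟩).comp
      (LinearMap.proj i)
  let π : (∀ i, Fin (a i) → M i) →ₗ[A] (∀ i, M i) :=
    LinearMap.pi fun i => (LinearMap.proj (R := A) (φ := fun _ : Fin (a i) => M i) ⟨0, ha i⟩).comp
      (LinearMap.proj i)
  have hπι : ∀ y, π (ι y) = y := by
    intro y
    funext i
    simp [π, ι]
  let φ : Module.End A (∀ i, M i) →ₙ+* Module.End A (∀ i, Fin (a i) → M i) :=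
    { toFun := fun r => ι.comp (r.comp π)
      map_mul' := fun r r' => by
        refine LinearMap.ext fun z => ?_
        simp [hπι]
      map_zero' := by simp
      map_add' := fun r r' => by
        refine LinearMap.ext fun z => ?_
        simp }
  have hφ : ∀ r z, φ r z = ι (r (π z)) := fun _ _ => rfl
  have hinj : Function.Injective φ := by
    intro r r' h
    refine LinearMap.ext fun y => ?_
    have := congrArg π (LinearMap.congr_fun h (ι y))
    simpa [hφ, hπι] using this
  have hsurj : ∀ s, ∃ r, φ r = φ 1 * s * φ 1 := fun s =>
    ⟨π.comp (s.comp ι), rfl⟩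
  let α : (j : Σ i, Fin (a i)) → (∀ i, M i) →ₗ[A] (∀ i, Fin (a i) → M i) := fun j =>
    (LinearMap.single A (fun i => Fin (a i) → M i) j.1).comp
      ((LinearMap.single A (fun _ : Fin (a j.1) => M j.1) j.2).comp (LinearMap.proj j.1))
  let β : (j : Σ i, Fin (a i)) → (∀ i, Fin (a i) → M i) →ₗ[A] (∀ i, M i) := fun j =>
    (LinearMap.single A M j.1).comp ((LinearMap.proj (R := A) (φ := fun _ : Fin (a j.1) => M j.1) j.2).comp
      (LinearMap.proj j.1))
  have hxy : ∑ j, (α j).comp π * φ 1 * ι.comp (β j) =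
      (1 : Module.End A (∀ i, Fin (a i) → M i)) := by
    refine LinearMap.ext fun z => ?_
    have h1 : ∀ j : Σ i, Fin (a i), ((α j).comp π * φ 1 * ι.comp (β j)) z =
        Pi.single j.1 (Pi.single j.2 (z j.1 j.2)) := by
      intro j
      simp [hφ, hπι, α, β]
    rw [LinearMap.sum_apply]
    simp_rw [h1]
    rw [Fintype.sum_sigma, Module.End.one_apply]
    refine Eq.trans ?_ (Finset.univ_sum_single z)
    refine Finset.sum_congr rfl fun i _ => ?_
    refine Eq.trans ?_ (congrArg (Pi.single i) (Finset.univ_sum_single (z i)))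
    exact (map_sum (AddMonoidHom.single (fun i => Fin (a i) → M i) i) _ _).symm
  refine ⟨CornerMorita.morita φ hinj hsurj hxy, ?_⟩
  refine CornerMorita.morita_quotient φ hsurj hxy
    (factorIdeal A (M 0) (∀ i, M i)).ringCon.mk' Quotient.mk_surjective
    (factorIdeal A (M 0) (∀ i, Fin (a i) → M i)).ringCon.mk' Quotient.mk_surjective ?_
  intro r
  have hq : ∀ r, (factorIdeal A (M 0) (∀ i, M i)).ringCon.mk' r = 0 ↔
      r ∈ factorIdeal A (M 0) (∀ i, M i) := fun r => RingCon.eq _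
  have hp : ∀ r, (factorIdeal A (M 0) (∀ i, Fin (a i) → M i)).ringCon.mk' r = 0 ↔
      r ∈ factorIdeal A (M 0) (∀ i, Fin (a i) → M i) := fun r => RingCon.eq _
  rw [hq, hp, mem_factorIdeal, mem_factorIdeal]
  constructor
  · rintro ⟨n, g, h, rfl⟩
    exact ⟨n, g.comp π, ι.comp h, rfl⟩
  · rintro ⟨n, g, h, hgh⟩
    refine ⟨n, g.comp ι, π.comp h, LinearMap.ext fun y => ?_⟩
    have := congrArg π (LinearMap.congr_fun hgh (ι y))
    simpa [hφ, hπι] using this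
end

section
/- Let A be a ring and M a left A-module. Then there is a ring isomorphism End_A(A ⊕ M)/[A] ≅ End_A(M)/J, where J is the two-sided ideal of End_A(M) consisting of all endomorphisms of M that factor through A^k for some natural number k. -/
section Helpers

variable {A : Type*} [Ring A] {M : Type*} [AddCommGroup M] [Module A M]

theorem mem_factorIdeal_of_comp {E : Type*} [AddCommGroup E] [Module A E] (k : ℕ)
    (g : E →ₗ[A] (Fin k → A)) (h : (Fin k → A) →ₗ[A] E) :
    (h.comp g : Module.End A E) ∈ factorIdeal A A E :=
  TwoSidedIdeal.subset_span ⟨k, g, h, rfl⟩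

theorem mem_factorIdeal_of_comp_one {E : Type*} [AddCommGroup E] [Module A E]
    (g : E →ₗ[A] A) (h : A →ₗ[A] E) :
    (h.comp g : Module.End A E) ∈ factorIdeal A A E := by
  have := mem_factorIdeal_of_comp 1 (LinearMap.pi fun _ => g) (h.comp (LinearMap.proj 0))
  exact this

theorem factorIdeal_quot_eq {E : Type*} [AddCommGroup E] [Module A E] {x y : Module.End A E}
    (h : x - y ∈ factorIdeal A A E) :
    (factorIdeal A A E).ringCon.mk' x = (factorIdeal A A E).ringCon.mk' y :=
  (RingCon.eq _).2 ((TwoSidedIdeal.rel_iff _ _ _).2 h)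

theorem factorIdeal_quot_zero {E : Type*} [AddCommGroup E] [Module A E] {x : Module.End A E}
    (h : x ∈ factorIdeal A A E) : (factorIdeal A A E).ringCon.mk' x = 0 :=
  (RingCon.eq _).2 h

theorem factorIdeal_ringCon_le {E : Type*} [AddCommGroup E] [Module A E] {S : Type*} [Ring S]
    (f : Module.End A E →+* S) (h : ∀ x ∈ factorsThroughSet A A E, f x = 0) :
    (factorIdeal A A E).ringCon ≤ RingCon.ker f := by
  have h1 : factorIdeal A A E ≤ TwoSidedIdeal.ker f :=
    TwoSidedIdeal.span_le.2 fun x hx => (TwoSidedIdeal.mem_ker f).2 (h x hx)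
  intro x y hxy
  exact (TwoSidedIdeal.ker_ringCon f).1 (TwoSidedIdeal.ringCon_le_iff.1 h1 hxy)

variable (A M)

/-- Compression to the `M`-corner, modulo `J`. -/
def toCorner : Module.End A (A × M) →+* (factorIdeal A A M).ringCon.Quotient where
  toFun f := (factorIdeal A A M).ringCon.mk'
    ((LinearMap.snd A A M).comp (f.comp (LinearMap.inr A A M)))
  map_one' := by
    rw [← map_one (factorIdeal A A M).ringCon.mk']
    congr 1
  map_zero' := by
    rw [← map_zero (factorIdeal A A M).ringCon.mk']
    congr 1
  map_add' f g := by
    rw [← map_add]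
    congr 1
  map_mul' f g := by
    rw [← map_mul]
    apply factorIdeal_quot_eq
    convert mem_factorIdeal_of_comp_one
      ((LinearMap.fst A A M).comp (g.comp (LinearMap.inr A A M)))
      ((LinearMap.snd A A M).comp (f.comp (LinearMap.inl A A M))) using 1
    ext m
    simp only [LinearMap.sub_apply, LinearMap.comp_apply, Module.End.mul_apply,
      LinearMap.snd_apply, LinearMap.inr_apply, LinearMap.fst_apply, LinearMap.inl_apply]
    rw [← Prod.snd_sub, ← map_sub]
    congr 2
    ext <;> simp

/-- Extension by zero, modulo `[A]`. -/
def fromCorner : Module.End A M →+* (factorIdeal A A (A × M)).ringCon.Quotient where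
  toFun f := (factorIdeal A A (A × M)).ringCon.mk'
    ((LinearMap.inr A A M).comp (f.comp (LinearMap.snd A A M)))
  map_one' := by
    rw [← map_one (factorIdeal A A (A × M)).ringCon.mk']
    symm
    apply factorIdeal_quot_eq
    convert mem_factorIdeal_of_comp_one (LinearMap.fst A A M) (LinearMap.inl A A M) using 1
    ext <;> simp
  map_zero' := by
    rw [← map_zero (factorIdeal A A (A × M)).ringCon.mk']
    congr 1
  map_add' f g := by
    rw [← map_add]
    congr 1
    ext <;> simp
  map_mul' f g := by
    rw [← map_mul]
    congr 1

theorem toCorner_le :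
    (factorIdeal A A (A × M)).ringCon ≤ RingCon.ker (toCorner A M) := by
  apply factorIdeal_ringCon_le
  rintro _ ⟨k, g, h, rfl⟩
  exact factorIdeal_quot_zero (mem_factorIdeal_of_comp k (g.comp (LinearMap.inr A A M))
    ((LinearMap.snd A A M).comp h))

theorem fromCorner_le :
    (factorIdeal A A M).ringCon ≤ RingCon.ker (fromCorner A M) := by
  apply factorIdeal_ringCon_le
  rintro _ ⟨k, g, h, rfl⟩
  exact factorIdeal_quot_zero (mem_factorIdeal_of_comp k (g.comp (LinearMap.snd A A M))
    ((LinearMap.inr A A M).comp h))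

end Helpers

/-- `End_A(A ⊕ M)/[A] ≅ End_A(M)/J` where `J` consists of the endomorphisms of
`M` factoring through some `A^k`. -/
theorem stmt2 (A : Type*) [Ring A] (M : Type*) [AddCommGroup M] [Module A M] :
    Nonempty ((factorIdeal A A (A × M)).ringCon.Quotient ≃+*
      (factorIdeal A A M).ringCon.Quotient) := by
  refine ⟨RingEquiv.ofRingHom (RingCon.lift _ (toCorner A M) (toCorner_le A M))
    (RingCon.lift _ (fromCorner A M) (fromCorner_le A M)) ?_ ?_⟩
  · ext f
    rfl
  · ext f
    change (factorIdeal A A (A × M)).ringCon.mk' ((LinearMap.inr A A M).comp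
      (((LinearMap.snd A A M).comp (f.comp (LinearMap.inr A A M))).comp
        (LinearMap.snd A A M))) = (factorIdeal A A (A × M)).ringCon.mk' f
    symm
    apply factorIdeal_quot_eq
    convert TwoSidedIdeal.add_mem _
      (mem_factorIdeal_of_comp_one ((LinearMap.fst A A M).comp f) (LinearMap.inl A A M))
      (mem_factorIdeal_of_comp_one (LinearMap.fst A A M) ((LinearMap.inr A A M).comp
        ((LinearMap.snd A A M).comp (f.comp (LinearMap.inl A A M))))) using 1
    have h0 : f (0, 0) = 0 := map_zero f
    ext <;> simp [h0]
end

section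
/- Let R be a commutative Noetherian ring, let M and N be finitely generated R-modules, and let p be a prime ideal of R. Then the localization at p of the quotient ring End_R(M)/[N] is isomorphic, as an R_p-algebra, to End_{R_p}(M_p)/[N_p], where M_p and N_p denote the localizations of M and N at p. -/
open TensorProduct

/-- The quotient of an `S`-algebra by a ring congruence is an `S`-algebra. -/
noncomputable def RingCon.quotientAlgebra' {S A : Type*} [CommSemiring S] [Semiring A]
    [Algebra S A] (c : RingCon A) : Algebra S c.Quotient :=
  RingHom.toAlgebra'
    ((c.mk' : A →+* c.Quotient).comp (algebraMap S A))
    (fun s x => by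
      induction x using Quotient.ind with
      | _ y => exact congrArg c.toQuotient (Algebra.commutes s y))

theorem mem_factorIdeal_iff (A : Type*) [Ring A] (N E : Type*) [AddCommGroup N] [AddCommGroup E]
    [Module A N] [Module A E] (f : Module.End A E) :
    f ∈ factorIdeal A N E ↔ f ∈ factorsThroughSet A N E := by
  constructor
  · intro hf
    let J : TwoSidedIdeal (Module.End A E) := TwoSidedIdeal.mk' (factorsThroughSet A N E)
      ⟨0, 0, 0, by simp⟩
      (by
        rintro _ _ ⟨k, g, h, rfl⟩ ⟨l, g', h', rfl⟩
        let e : (Fin (k + l) → N) ≃ₗ[A] (Fin k → N) × (Fin l → N) :=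
          (LinearEquiv.funCongrLeft A N finSumFinEquiv).trans
            (LinearEquiv.sumArrowLequivProdArrow (Fin k) (Fin l) A N)
        refine ⟨k + l, e.symm.toLinearMap ∘ₗ (g.prod g'), (h.coprod h') ∘ₗ e.toLinearMap, ?_⟩
        ext x
        simp)
      (by
        rintro _ ⟨k, g, h, rfl⟩
        exact ⟨k, g, -h, by ext; simp⟩)
      (by
        rintro x _ ⟨k, g, h, rfl⟩
        exact ⟨k, g, x ∘ₗ h, rfl⟩)
      (by
        rintro _ y ⟨k, g, h, rfl⟩
        exact ⟨k, g ∘ₗ y, h, rfl⟩)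
    have hJ : factorIdeal A N E ≤ J := by
      refine TwoSidedIdeal.span_le.2 ?_
      intro x hx
      exact (TwoSidedIdeal.mem_mk' _ _ _ _ _ _ _).2 hx
    exact (TwoSidedIdeal.mem_mk' _ _ _ _ _ _ _).1 (hJ hf)
  · intro hf
    exact TwoSidedIdeal.subset_span hf

theorem quotient_localization_aux0 {R : Type*} [CommRing R] (S : Submonoid R)
    (L : Type*) [CommRing L] [Algebra R L] [IsLocalization S L]
    {E E' Q Q' : Type*} [Ring E] [Ring E'] [Ring Q] [Ring Q']
    [Algebra R E] [Algebra R Q] [Algebra R E'] [Algebra L E'] [IsScalarTower R L E']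
    [Algebra R Q'] [Algebra L Q'] [IsScalarTower R L Q']
    (F : E →ₗ[R] E') [IsLocalizedModule S F] (F1 : F 1 = 1)
    (Fmul : ∀ x y, F (x * y) = F x * F y)
    (π : E →+* Q) (hπ : Function.Surjective π) (hπa : ∀ r, algebraMap R Q r = π (algebraMap R E r))
    (π' : E' →+* Q') (hπ' : Function.Surjective π')
    (ham : ∀ x, algebraMap L Q' x = π' (algebraMap L E' x))
    (h1 : ∀ x, π x = 0 → π' (F x) = 0)
    (h2 : ∀ x, π' (F x) = 0 → ∃ s ∈ S, π (s • x) = 0) :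
    ∃ e : (L ⊗[R] Q) ≃+* Q', ∀ x : L, e (x ⊗ₜ[R] (1 : Q)) = π' (algebraMap L E' x) := by
  have hamR : ∀ x, algebraMap R Q' x = π' (algebraMap R E' x) := fun x => by
    rw [IsScalarTower.algebraMap_apply R L Q', ham, ← IsScalarTower.algebraMap_apply]
  have hsm : ∀ (r : R) x, π (r • x) = r • π x := fun r x => by
    rw [Algebra.smul_def, Algebra.smul_def, map_mul, hπa]
  have hsm' : ∀ (r : R) x, π' (r • x) = r • π' x := fun r x => by
    rw [Algebra.smul_def, Algebra.smul_def, map_mul, hamR]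
  let FR : E →+* E' :=
    { toFun := F, map_one' := F1, map_mul' := Fmul, map_zero' := map_zero F, map_add' := map_add F }
  have hker : ∀ a b, π a = π b → π' (F a) = π' (F b) := fun a b hab => by
    rw [← sub_eq_zero, ← map_sub, ← map_sub]
    exact h1 _ (by rw [map_sub, hab, sub_self])
  let φ0 : Q →+* Q' := RingHom.liftOfSurjective π hπ
    ⟨π'.comp FR, fun a ha => h1 a ha⟩
  have hφ0 : ∀ a, φ0 (π a) = π' (F a) := fun a =>
    RingHom.liftOfRightInverse_comp_apply π _ _ ⟨π'.comp FR, fun a ha => h1 a ha⟩ a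
  let φ : Q →ₐ[R] Q' := { φ0 with
    commutes' := fun r => by
      change φ0 _ = _
      rw [hπa, hφ0, hamR, Algebra.algebraMap_eq_smul_one, map_smul, F1,
        ← Algebra.algebraMap_eq_smul_one] }
  have hφ : ∀ a, φ (π a) = π' (F a) := hφ0
  have : IsLocalizedModule S φ.toLinearMap := by
    refine ⟨?_, ?_, ?_⟩
    · intro s
      have hu := (IsLocalization.map_units L s).map (Algebra.lsmul R R Q' : L →ₐ[R] _)
      convert hu using 1
      ext x
      simp
    · intro y
      obtain ⟨y, rfl⟩ := hπ' y
      obtain ⟨⟨x, s⟩, hx⟩ := IsLocalizedModule.surj S F y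
      refine ⟨⟨π x, s⟩, ?_⟩
      change (s : R) • _ = φ (π x)
      rw [hφ, ← hsm']
      exact congrArg π' hx
    · intro x y hxy
      obtain ⟨x, rfl⟩ := hπ x
      obtain ⟨y, rfl⟩ := hπ y
      change φ _ = φ _ at hxy
      rw [hφ, hφ, ← sub_eq_zero, ← map_sub, ← map_sub] at hxy
      obtain ⟨s, hs, h⟩ := h2 _ hxy
      refine ⟨⟨s, hs⟩, ?_⟩
      change s • π x = s • π y
      rw [← sub_eq_zero, ← smul_sub, ← map_sub, ← hsm, h]
  have hb : IsBaseChange L φ.toLinearMap := (isLocalizedModule_iff_isBaseChange S L _).1 inferInstance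
  let Ψ : L ⊗[R] Q →ₐ[L] Q' := Algebra.TensorProduct.lift (Algebra.ofId L Q') φ
    (fun x y => Algebra.commutes _ _)
  have hΨt : ∀ (x : L) (y : Q), Ψ (x ⊗ₜ[R] y) = Algebra.ofId L Q' x * φ y := fun x y =>
    Algebra.TensorProduct.lift_tmul _ _ _ _ _
  have hΨ : ∀ z, Ψ z = hb.equiv z := by
    intro z
    induction z with
    | zero => simp
    | add a b ha hb => rw [map_add, map_add, ha, hb]
    | tmul a b =>
      rw [IsBaseChange.equiv_tmul]
      rw [hΨt, Algebra.smul_def, Algebra.ofId_apply]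
      rfl
  have hbij : Function.Bijective Ψ := by
    have : (Ψ : L ⊗[R] Q → Q') = hb.equiv := funext hΨ
    rw [this]
    exact hb.equiv.bijective
  refine ⟨RingEquiv.ofBijective Ψ hbij, fun x => ?_⟩
  change Ψ (x ⊗ₜ[R] (1 : Q)) = _
  rw [hΨt, map_one, mul_one, Algebra.ofId_apply, ham]

theorem quotient_localization_aux {R : Type*} [CommRing R] (S : Submonoid R)
    (L : Type*) [CommRing L] [Algebra R L] [IsLocalization S L]
    {E E' Q Q' : Type*} [Ring E] [Ring E'] [Ring Q] [Ring Q']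
    [Algebra R E] [Algebra R Q] [Algebra R E'] [Algebra L E'] [IsScalarTower R L E']
    (F : E →ₗ[R] E') [IsLocalizedModule S F] (F1 : F 1 = 1)
    (Fmul : ∀ x y, F (x * y) = F x * F y)
    (π : E →+* Q) (hπ : Function.Surjective π) (hπa : ∀ r, algebraMap R Q r = π (algebraMap R E r))
    (π' : E' →+* Q') (hπ' : Function.Surjective π')
    (h1 : ∀ x, π x = 0 → π' (F x) = 0)
    (h2 : ∀ x, π' (F x) = 0 → ∃ s ∈ S, π (s • x) = 0) :
    ∃ e : (L ⊗[R] Q) ≃+* Q', ∀ x : L, e (x ⊗ₜ[R] (1 : Q)) = π' (algebraMap L E' x) := by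
  let _ : Algebra L Q' := RingHom.toAlgebra' (π'.comp (algebraMap L E')) (by
    intro c x
    obtain ⟨y, rfl⟩ := hπ' x
    simp only [RingHom.comp_apply, ← map_mul, Algebra.commutes])
  let _ : Algebra R Q' := RingHom.toAlgebra' ((algebraMap L Q').comp (algebraMap R L)) (by
    intro c x
    exact Algebra.commutes (algebraMap R L c) x)
  have : IsScalarTower R L Q' := IsScalarTower.of_algebraMap_eq fun _ => rfl
  have ham : ∀ x, algebraMap L Q' x = π' (algebraMap L E' x) := fun _ => rfl
  exact quotient_localization_aux0 S L F F1 Fmul π hπ hπa π' hπ' ham h1 h2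

section
variable {R : Type*} [CommRing R] (S : Submonoid R) {A B C A' B' C' : Type*}
  [AddCommGroup A] [AddCommGroup B] [AddCommGroup C] [AddCommGroup A'] [AddCommGroup B']
  [AddCommGroup C'] [Module R A] [Module R B] [Module R C] [Module R A'] [Module R B'] [Module R C']
  (L : Type*) [CommRing L] [Algebra R L] [IsLocalization S L]
  [Module L A'] [Module L B'] [Module L C'] [IsScalarTower R L A'] [IsScalarTower R L B']
  [IsScalarTower R L C']
  (a : A →ₗ[R] A') (b : B →ₗ[R] B') (c : C →ₗ[R] C')
  [IsLocalizedModule S a] [IsLocalizedModule S b] [IsLocalizedModule S c]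

theorem mapExtendScalars_comp_aux (g : A →ₗ[R] B) (h : B →ₗ[R] C) :
    IsLocalizedModule.mapExtendScalars S a c L (h ∘ₗ g) =
      IsLocalizedModule.mapExtendScalars S b c L h ∘ₗ
        IsLocalizedModule.mapExtendScalars S a b L g := by
  apply LinearMap.restrictScalars_injective R
  apply IsLocalizedModule.linearMap_ext S a c
  ext x
  simp

end

/-- for a commutative Noetherian ring `R`, finitely generated `R`-modules `M`
and `N` and a prime `p`, the localization `R_p ⊗_R (End_R(M)/[N])` of `End_R(M)/[N]` at `p`
is isomorphic, as an `R_p`-algebra, to `End_{R_p}(M_p)/[N_p]`. -/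
theorem stmt4 (R : Type*) [CommRing R] [IsNoetherianRing R]
    (M N : Type*) [AddCommGroup M] [Module R M] [Module.Finite R M]
    [AddCommGroup N] [Module R N] [Module.Finite R N]
    (p : Ideal R) [p.IsPrime] :
    letI : Algebra R ((factorIdeal R N M).ringCon.Quotient) :=
      (factorIdeal R N M).ringCon.quotientAlgebra'
    ∃ e : (Localization p.primeCompl ⊗[R] ((factorIdeal R N M).ringCon.Quotient)) ≃+*
        (factorIdeal (Localization p.primeCompl) (LocalizedModule p.primeCompl N)
          (LocalizedModule p.primeCompl M)).ringCon.Quotient,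
      ∀ x : Localization p.primeCompl,
        e (x ⊗ₜ[R] (1 : (factorIdeal R N M).ringCon.Quotient)) =
          (factorIdeal (Localization p.primeCompl) (LocalizedModule p.primeCompl N)
              (LocalizedModule p.primeCompl M)).ringCon.mk'
            (algebraMap (Localization p.primeCompl)
              (Module.End (Localization p.primeCompl) (LocalizedModule p.primeCompl M)) x) := by
  let S := p.primeCompl
  let L := Localization S
  let a := LocalizedModule.mkLinearMap S M
  let b := LocalizedModule.mkLinearMap S N
  let F : Module.End R M →ₗ[R] Module.End L (LocalizedModule S M) :=
    IsLocalizedModule.mapExtendScalars S a a L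
  have : Module.FinitePresentation R M := Module.finitePresentation_of_finite R M
  have hF : IsLocalizedModule S F :=
    Module.FinitePresentation.isLocalizedModule_mapExtendScalars S a a L
  have F1 : F 1 = 1 := LocalizedModule.map_id S
  have Fmul : ∀ x y, F (x * y) = F x * F y := fun x y =>
    mapExtendScalars_comp_aux S L a a a y x
  have mk0 : ∀ {T : Type _} [Ring T] (I : TwoSidedIdeal T) (x : T),
      I.ringCon.mk' x = 0 ↔ x ∈ I := by
    intro T _ I x
    rw [TwoSidedIdeal.mem_iff]
    exact RingCon.eq I.ringCon
  have mk0' : ∀ {T : Type _} [Ring T] (I : TwoSidedIdeal T) (x : T),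
      I.ringCon.mk' x = 0 ↔ x ∈ I := by
    intro T _ I x
    rw [TwoSidedIdeal.mem_iff]
    exact RingCon.eq I.ringCon
  refine quotient_localization_aux S L F F1 Fmul (factorIdeal R N M).ringCon.mk'
    (RingCon.mk'_surjective _) (fun r => rfl)
    (factorIdeal L (LocalizedModule S N) (LocalizedModule S M)).ringCon.mk'
    (RingCon.mk'_surjective _) ?_ ?_
  · intro x hx
    rw [mk0, mem_factorIdeal_iff] at hx
    rw [mk0', mem_factorIdeal_iff]
    obtain ⟨k, g, h, rfl⟩ := hx
    let bk : (Fin k → N) →ₗ[R] (Fin k → LocalizedModule S N) :=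
      .pi fun i => b ∘ₗ .proj i
    have : IsLocalizedModule S bk := inferInstance
    exact ⟨k, IsLocalizedModule.mapExtendScalars S a bk L g,
      IsLocalizedModule.mapExtendScalars S bk a L h, mapExtendScalars_comp_aux S L a bk a g h⟩
  · intro x hx
    rw [mk0', mem_factorIdeal_iff] at hx
    obtain ⟨k, g', h', hgh⟩ := hx
    let bk : (Fin k → N) →ₗ[R] (Fin k → LocalizedModule S N) :=
      .pi fun i => b ∘ₗ .proj i
    have : IsLocalizedModule S bk := inferInstance
    have : Module.FinitePresentation R (Fin k → N) := Module.finitePresentation_of_finite R _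
    obtain ⟨⟨g, s⟩, hg⟩ := IsLocalizedModule.surj S
      (IsLocalizedModule.mapExtendScalars S a bk L) g'
    obtain ⟨⟨h, t⟩, hh⟩ := IsLocalizedModule.surj S
      (IsLocalizedModule.mapExtendScalars S bk a L) h'
    have key : F (((t : R) * s) • x) = F (h ∘ₗ g) := by
      rw [map_smul, hgh]
      refine Eq.trans ?_ (mapExtendScalars_comp_aux S L a bk a g h).symm
      change (s : R) • g' = _ at hg
      change (t : R) • h' = _ at hh
      rw [← hg, ← hh, mul_smul]
      ext z
      simp
    obtain ⟨u, hu⟩ := IsLocalizedModule.exists_of_eq (S := S) key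
    change (u : R) • (((t : R) * s) • x) = (u : R) • (h ∘ₗ g) at hu
    refine ⟨u * (t * s), mul_mem u.2 (mul_mem t.2 s.2), ?_⟩
    rw [mk0, mem_factorIdeal_iff, mul_smul, hu]
    exact ⟨k, g, (u : R) • h, by ext; simp⟩
end

section
/- Let (R, m) be a commutative Noetherian local ring with m-adic completion R̂, and let M and N be finitely generated R-modules with m-adic completions M̂ and N̂. Then R̂ ⊗_R (End_R(M)/[N]) is isomorphic, as an R̂-algebra, to End_{R̂}(M̂)/[N̂]. -/
open TensorProduct

section Core

variable {R S A B : Type*} [CommRing R] [CommRing S] [Algebra R S] [Ring A] [Algebra R A]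
  [Ring B] [Algebra S B]

/-- The quotient map `S ⊗ A → S ⊗ A/I`. -/
noncomputable def coreα (S : Type*) [CommRing S] [Algebra R S] (I : TwoSidedIdeal A) :
    S ⊗[R] A →ₐ[S] S ⊗[R] I.ringCon.Quotient :=
  Algebra.TensorProduct.map (AlgHom.id S S) (I.ringCon.mkₐ R)

theorem mk'_eq_zero_iff (I : TwoSidedIdeal A) (a : A) : I.ringCon.mk' a = 0 ↔ a ∈ I := by
  rw [← TwoSidedIdeal.mem_ker, TwoSidedIdeal.ker_ringCon_mk']

theorem coreα_tmul (I : TwoSidedIdeal A) (s : S) (a : A) :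
    coreα S I (s ⊗ₜ[R] a) = s ⊗ₜ[R] I.ringCon.mk' a := rfl

theorem coreα_surjective (I : TwoSidedIdeal A) :
    Function.Surjective (coreα (R := R) S I) := by
  intro t
  induction t with
  | zero => exact ⟨0, map_zero _⟩
  | add x y hx hy =>
    obtain ⟨a, rfl⟩ := hx
    obtain ⟨b, rfl⟩ := hy
    exact ⟨a + b, map_add _ _ _⟩
  | tmul s q =>
    obtain ⟨a, rfl⟩ := RingCon.mk'_surjective I.ringCon q
    exact ⟨s ⊗ₜ a, coreα_tmul I s a⟩

theorem coreα_ker (I : TwoSidedIdeal A) (J : TwoSidedIdeal B) (φ : S ⊗[R] A ≃ₐ[S] B)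
    (key : ∀ f ∈ I, φ (1 ⊗ₜ f) ∈ J) (t : S ⊗[R] A) (ht : coreα S I t = 0) : φ t ∈ J := by
  let m : A →ₗ[R] I.ringCon.Quotient := (I.ringCon.mkₐ R).toLinearMap
  have hex : Function.Exact (LinearMap.ker m).subtype m := LinearMap.exact_subtype_ker_map _
  have hex' := lTensor_exact S hex (RingCon.mk'_surjective _)
  obtain ⟨w, rfl⟩ := (hex' t).1 ht
  clear ht
  induction w with
  | zero => rw [map_zero, map_zero]; exact J.zero_mem
  | add x y hx hy => rw [map_add, map_add]; exact J.add_mem hx hy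
  | tmul s f =>
    have hf : (f : A) ∈ I := (mk'_eq_zero_iff I _).1 f.2
    have h4 : φ (s ⊗ₜ (f : A)) = algebraMap S B s * φ (1 ⊗ₜ (f : A)) := by
      rw [← Algebra.smul_def, ← map_smul, TensorProduct.smul_tmul', smul_eq_mul, mul_one]
    rw [LinearMap.lTensor_tmul, Submodule.subtype_apply, h4]
    exact J.mul_mem_left _ _ (key f hf)

theorem core_key (I : TwoSidedIdeal A) (J : TwoSidedIdeal B) (φ : S ⊗[R] A ≃ₐ[S] B)
    (X : Set A) (hI : I = TwoSidedIdeal.span X)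
    (h1 : ∀ f ∈ X, φ (1 ⊗ₜ f) ∈ J) : ∀ f ∈ I, φ (1 ⊗ₜ f) ∈ J := by
  let ι : A →+* S ⊗[R] A := (Algebra.TensorProduct.includeRight : A →ₐ[R] S ⊗[R] A).toRingHom
  let κ : A →+* J.ringCon.Quotient := J.ringCon.mk'.comp ((φ : S ⊗[R] A →+* B).comp ι)
  have h : I ≤ TwoSidedIdeal.ker κ := by
    rw [hI]
    exact TwoSidedIdeal.span_le.2 fun f hf =>
      (TwoSidedIdeal.mem_ker κ).2 ((mk'_eq_zero_iff J _).2 (h1 f hf))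
  intro f hf
  exact (mk'_eq_zero_iff J _).1 ((TwoSidedIdeal.mem_ker κ).1 (h hf))

/-- Abstract descent of an isomorphism `S ⊗ A ≃ B` to quotients by two-sided ideals. -/
theorem core_quot (I : TwoSidedIdeal A) (J : TwoSidedIdeal B) (φ : S ⊗[R] A ≃ₐ[S] B)
    (X : Set A) (Y : Set B) (hI : I = TwoSidedIdeal.span X) (hJ : J = TwoSidedIdeal.span Y)
    (h1 : ∀ f ∈ X, φ (1 ⊗ₜ f) ∈ J)
    (h2 : ∀ y ∈ Y, coreα S I (φ.symm y) = 0) :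
    ∃ e : (S ⊗[R] I.ringCon.Quotient) ≃+* J.ringCon.Quotient,
      ∀ x : S, e (x ⊗ₜ[R] (1 : I.ringCon.Quotient)) =
        J.ringCon.mk' (algebraMap S B x) := by
  let γ : B →+* S ⊗[R] I.ringCon.Quotient :=
    (coreα S I).toRingHom.comp (φ.symm : B →+* S ⊗[R] A)
  have hγa : ∀ b, γ b = coreα S I (φ.symm b) := fun b => rfl
  have hγ : J ≤ TwoSidedIdeal.ker γ := by
    rw [hJ]
    exact TwoSidedIdeal.span_le.2 fun y hy => (TwoSidedIdeal.mem_ker γ).2 (h2 y hy)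
  have hγ' : J.ringCon ≤ RingCon.ker γ := fun x y h => by
    have h5 := (TwoSidedIdeal.mem_ker γ).1 (hγ ((TwoSidedIdeal.rel_iff J x y).1 h))
    rw [map_sub, sub_eq_zero] at h5
    exact h5
  have hγs : Function.Surjective γ := (coreα_surjective I).comp φ.symm.surjective
  have hk := core_key I J φ X hI h1
  have hγk : ∀ b, γ b = 0 → b ∈ J := fun b hb => by
    have := coreα_ker I J φ hk (φ.symm b) hb
    rwa [φ.apply_symm_apply] at this
  obtain ⟨δ, hδ⟩ : ∃ δ : J.ringCon.Quotient →+* S ⊗[R] I.ringCon.Quotient,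
      ∀ b, δ (J.ringCon.mk' b) = γ b := ⟨J.ringCon.lift γ hγ', fun b => rfl⟩
  have hγx : ∀ x : S, γ (algebraMap S B x) = x ⊗ₜ[R] (1 : I.ringCon.Quotient) := fun x => by
    rw [hγa, AlgEquiv.commutes, Algebra.TensorProduct.algebraMap_apply, coreα_tmul, map_one]
    rfl
  clear_value γ
  have hδs : Function.Surjective δ := fun t => by
    obtain ⟨b, rfl⟩ := hγs t
    exact ⟨_, hδ b⟩
  have hδi : Function.Injective δ := by
    rw [injective_iff_map_eq_zero]
    intro q hq
    obtain ⟨b, rfl⟩ := RingCon.mk'_surjective J.ringCon q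
    rw [hδ] at hq
    exact (mk'_eq_zero_iff J b).2 (hγk b hq)
  have hδb : Function.Bijective δ := ⟨hδi, hδs⟩
  refine ⟨(RingEquiv.ofBijective δ hδb).symm, fun x => ?_⟩
  rw [RingEquiv.symm_apply_eq, RingEquiv.ofBijective_apply, hδ, hγx]

end Core

section Main

variable {R S M N M' N' : Type*} [CommRing R] [CommRing S] [Algebra R S]
  [AddCommGroup M] [Module R M] [AddCommGroup N] [Module R N]
  [AddCommGroup M'] [Module S M'] [AddCommGroup N'] [Module S N']

theorem comp_mem_factorIdeal (a : M →ₗ[R] N) (b : N →ₗ[R] M) :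
    b ∘ₗ a ∈ factorIdeal R N M := by
  refine TwoSidedIdeal.subset_span ⟨1, LinearMap.pi fun _ => a, b ∘ₗ LinearMap.proj 0, ?_⟩
  ext x; simp

theorem factors_eq_sum {f : Module.End R M} (hf : f ∈ factorsThroughSet R N M) :
    ∃ (k : ℕ) (a : Fin k → M →ₗ[R] N) (b : Fin k → N →ₗ[R] M), f = ∑ i, b i ∘ₗ a i := by
  obtain ⟨k, g, h, rfl⟩ := hf
  refine ⟨k, fun i => LinearMap.proj i ∘ₗ g, fun i => h ∘ₗ LinearMap.single R (fun _ => N) i, ?_⟩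
  ext x
  simp only [LinearMap.comp_apply, LinearMap.sum_apply, LinearMap.proj_apply, LinearMap.single_apply]
  rw [← map_sum, Finset.univ_sum_single]

variable (R S M) in
/-- `S ⊗ End_R M ≃ End_S (S ⊗ M)` as algebras. -/
noncomputable def endBC (h : IsBaseChange S (LinearMap.baseChangeHom R S M M)) :
    S ⊗[R] Module.End R M ≃ₐ[S] Module.End S (S ⊗[R] M) :=
  Algebra.TensorProduct.algEquivOfLinearEquivTensorProduct h.equiv
    (fun s t f g => by
      erw [h.equiv_tmul, h.equiv_tmul, h.equiv_tmul]
      ext x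
      simp [mul_smul, LinearMap.baseChange_mul, smul_comm s t])
    (by
      erw [h.equiv_tmul]
      ext x
      simp)

theorem endBC_tmul (h : IsBaseChange S (LinearMap.baseChangeHom R S M M)) (s : S)
    (f : Module.End R M) : endBC R S M h (s ⊗ₜ f) = s • LinearMap.baseChange S f :=
  h.equiv_tmul s f

theorem main_bc [Module.Flat R S] [Module.FinitePresentation R M] [Module.FinitePresentation R N]
    (eM : S ⊗[R] M ≃ₗ[S] M') (eN : S ⊗[R] N ≃ₗ[S] N') :
    ∃ e : (S ⊗[R] (factorIdeal R N M).ringCon.Quotient) ≃+*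
        (factorIdeal S N' M').ringCon.Quotient,
      ∀ x : S, e (x ⊗ₜ[R] (1 : (factorIdeal R N M).ringCon.Quotient)) =
        (factorIdeal S N' M').ringCon.mk' (algebraMap S (Module.End S M') x) := by
  have hMM := Module.FinitePresentation.isBaseChange_map R M M S
  have hMN := Module.FinitePresentation.isBaseChange_map R M N S
  have hNM := Module.FinitePresentation.isBaseChange_map R N M S
  refine core_quot _ _ ((endBC R S M hMM).trans (eM.conjAlgEquiv S)) _ _ rfl rfl ?_ ?_
  · intro f hf
    obtain ⟨k, a, b, rfl⟩ := factors_eq_sum hf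
    rw [TensorProduct.tmul_sum, map_sum]
    refine sum_mem fun i _ => ?_
    have : ((endBC R S M hMM).trans (eM.conjAlgEquiv S)) (1 ⊗ₜ (b i ∘ₗ a i)) =
        (eM.toLinearMap ∘ₗ (b i).baseChange S ∘ₗ eN.symm.toLinearMap) ∘ₗ
          (eN.toLinearMap ∘ₗ (a i).baseChange S ∘ₗ eM.symm.toLinearMap) := by
      rw [AlgEquiv.trans_apply, endBC_tmul]
      ext x
      simp [LinearEquiv.conjAlgEquiv_apply, LinearMap.baseChange_comp]
    rw [this]
    exact comp_mem_factorIdeal _ _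
  · intro y hy
    obtain ⟨k, a, b, rfl⟩ := factors_eq_sum hy
    rw [map_sum, map_sum]
    refine Finset.sum_eq_zero fun i _ => ?_
    obtain ⟨u, hu⟩ : ∃ u, u = eN.symm.toLinearMap ∘ₗ a i ∘ₗ eM.toLinearMap := ⟨_, rfl⟩
    obtain ⟨v, hv⟩ : ∃ v, v = eM.symm.toLinearMap ∘ₗ b i ∘ₗ eN.toLinearMap := ⟨_, rfl⟩
    have : ((endBC R S M hMM).trans (eM.conjAlgEquiv S)).symm (b i ∘ₗ a i) =
        (endBC R S M hMM).symm (v ∘ₗ u) := by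
      rw [AlgEquiv.symm_apply_eq, AlgEquiv.trans_apply, AlgEquiv.apply_symm_apply]
      ext x
      simp [LinearEquiv.conjAlgEquiv_apply, hu, hv]
    rw [this]
    clear this hu hv
    induction u using hMN.inductionOn with
    | zero => simp
    | add x y hx hy => rw [LinearMap.comp_add, map_add, map_add, hx, hy, add_zero]
    | smul s x hx => rw [LinearMap.comp_smul, map_smul, map_smul, hx, smul_zero]
    | tmul g =>
      induction v using hNM.inductionOn with
      | zero => simp
      | add x y hx hy => rw [LinearMap.add_comp, map_add, map_add, hx, hy, add_zero]
      | smul s x hx => rw [LinearMap.smul_comp, map_smul, map_smul, hx, smul_zero]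
      | tmul h =>
        have : (endBC R S M hMM).symm (LinearMap.baseChangeHom R S N M h ∘ₗ
            LinearMap.baseChangeHom R S M N g) = 1 ⊗ₜ (h ∘ₗ g) := by
          rw [AlgEquiv.symm_apply_eq, endBC_tmul, one_smul, LinearMap.baseChange_comp]
          rfl
        rw [this, coreα_tmul]
        have h0 : (factorIdeal R N M).ringCon.mk' (h ∘ₗ g) = 0 := by
          rw [← TwoSidedIdeal.mem_ker, TwoSidedIdeal.ker_ringCon_mk']
          exact comp_mem_factorIdeal _ _
        rw [h0, TensorProduct.tmul_zero]

theorem exists_completion_equiv {R : Type*} [CommRing R] [IsNoetherianRing R] (I : Ideal R)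
    (M : Type*) [AddCommGroup M] [Module R M] [Module.Finite R M] :
    Nonempty (AdicCompletion I R ⊗[R] M ≃ₗ[AdicCompletion I R] AdicCompletion I M) := by
  obtain ⟨n, f, hf⟩ := Module.Finite.exists_fin' R M
  let e := f.quotKerEquivOfSurjective hf
  exact ⟨(TensorProduct.AlgebraTensorModule.congr
    (LinearEquiv.refl (AdicCompletion I R) (AdicCompletion I R)) e.symm).trans
    ((AdicCompletion.ofTensorProductEquivOfFiniteNoetherian I _).trans
      (AdicCompletion.congr I e))⟩

end Main

/-- for a commutative Noetherian local ring `(R, 𝔪)` with `𝔪`-adic completion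
`R̂` and finitely generated `R`-modules `M`, `N` with completions `M̂`, `N̂`, one has
`R̂ ⊗_R (End_R(M)/[N]) ≅ End_{R̂}(M̂)/[N̂]` as `R̂`-algebras. -/
theorem stmt5 (R : Type*) [CommRing R] [IsNoetherianRing R] [IsLocalRing R]
    (M N : Type*) [AddCommGroup M] [Module R M] [Module.Finite R M]
    [AddCommGroup N] [Module R N] [Module.Finite R N] :
    letI : Algebra R ((factorIdeal R N M).ringCon.Quotient) :=
      (factorIdeal R N M).ringCon.quotientAlgebra'
    ∃ e : (AdicCompletion (IsLocalRing.maximalIdeal R) R ⊗[R]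
          ((factorIdeal R N M).ringCon.Quotient)) ≃+*
        (factorIdeal (AdicCompletion (IsLocalRing.maximalIdeal R) R)
          (AdicCompletion (IsLocalRing.maximalIdeal R) N)
          (AdicCompletion (IsLocalRing.maximalIdeal R) M)).ringCon.Quotient,
      ∀ x : AdicCompletion (IsLocalRing.maximalIdeal R) R,
        e (x ⊗ₜ[R] (1 : (factorIdeal R N M).ringCon.Quotient)) =
          (factorIdeal (AdicCompletion (IsLocalRing.maximalIdeal R) R)
              (AdicCompletion (IsLocalRing.maximalIdeal R) N)
              (AdicCompletion (IsLocalRing.maximalIdeal R) M)).ringCon.mk'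
            (algebraMap (AdicCompletion (IsLocalRing.maximalIdeal R) R)
              (Module.End (AdicCompletion (IsLocalRing.maximalIdeal R) R)
                (AdicCompletion (IsLocalRing.maximalIdeal R) M)) x) := by
  obtain ⟨eM⟩ := exists_completion_equiv (IsLocalRing.maximalIdeal R) M
  obtain ⟨eN⟩ := exists_completion_equiv (IsLocalRing.maximalIdeal R) N
  have := Module.finitePresentation_of_finite R M
  have := Module.finitePresentation_of_finite R N
  have key := main_bc eM eN
  have hA : (factorIdeal R N M).ringCon.quotientAlgebra' (S := R) =
      (inferInstance : Algebra R (factorIdeal R N M).ringCon.Quotient) :=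
    Algebra.algebra_ext _ _ fun _ => rfl
  rw [hA]
  exact key
end

section
/- Let R be a commutative Noetherian local ℂ-algebra whose residue field R/m is isomorphic to ℂ, and let M be a finitely generated R-module. Then End_R(R ⊕ M)/[R] is finite-dimensional as a ℂ-vector space if and only if M_p is a free R_p-module for every non-maximal prime ideal p of R. -/
universe v

theorem aux_exists_complex {R : Type*} [CommRing R] [IsLocalRing R] [Algebra ℂ R]
    (hres : Nonempty (IsLocalRing.ResidueField R ≃ₐ[ℂ] ℂ)) (r : R) :
    ∃ c : ℂ, r - algebraMap ℂ R c ∈ IsLocalRing.maximalIdeal R := by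
  obtain ⟨e⟩ := hres
  refine ⟨e (IsLocalRing.residue R r), ?_⟩
  rw [← IsLocalRing.residue_eq_zero_iff, map_sub, sub_eq_zero]
  apply e.injective
  have : IsLocalRing.residue R (algebraMap ℂ R (e (IsLocalRing.residue R r)))
      = algebraMap ℂ (IsLocalRing.ResidueField R) (e (IsLocalRing.residue R r)) := rfl
  rw [this, e.commutes]
  rfl

theorem aux_finite_killed {R : Type*} [CommRing R] [IsLocalRing R] [Algebra ℂ R]
    (hres : Nonempty (IsLocalRing.ResidueField R ≃ₐ[ℂ] ℂ))
    (N : Type*) [AddCommGroup N] [Module R N] [Module ℂ N] [IsScalarTower ℂ R N]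
    [Module.Finite R N] (h : ∀ r ∈ IsLocalRing.maximalIdeal R, ∀ x : N, r • x = 0) :
    Module.Finite ℂ N := by
  obtain ⟨S, hS⟩ := (Module.Finite.fg_top : (⊤ : Submodule R N).FG)
  refine ⟨⟨S, ?_⟩⟩
  rw [eq_top_iff]
  intro x _
  have hx : x ∈ Submodule.span R (S : Set N) := hS ▸ Submodule.mem_top
  induction hx using Submodule.span_induction with
  | mem x hx => exact Submodule.subset_span hx
  | zero => exact zero_mem _
  | add x y _ _ h1 h2 => exact add_mem (h1 trivial) (h2 trivial)
  | smul r x _ h1 =>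
    obtain ⟨c, hc⟩ := aux_exists_complex hres r
    have := h _ hc x
    rw [sub_smul, sub_eq_zero, algebraMap_smul] at this
    rw [this]
    exact Submodule.smul_mem _ _ (h1 trivial)

theorem aux_finite_pow {R : Type*} [CommRing R] [IsLocalRing R] [IsNoetherianRing R] [Algebra ℂ R]
    (hres : Nonempty (IsLocalRing.ResidueField R ≃ₐ[ℂ] ℂ)) (n : ℕ) :
    ∀ (N : Type v) [AddCommGroup N] [Module R N] [Module ℂ N] [IsScalarTower ℂ R N]
    [Module.Finite R N] (_ : ∀ r ∈ IsLocalRing.maximalIdeal R ^ n, ∀ x : N, r • x = 0),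
    Module.Finite ℂ N := by
  induction n with
  | zero =>
    intro N _ _ _ _ _ h
    refine aux_finite_killed hres N fun r _ => h r (by simp)
  | succ n ih =>
    intro N _ _ _ _ _ h
    let N' : Submodule R N := IsLocalRing.maximalIdeal R • ⊤
    have h1 : Module.Finite ℂ N' := by
      apply ih
      rintro r hr ⟨x, hx⟩
      apply Subtype.ext
      change r • x = 0
      induction hx using Submodule.smul_induction_on' with
      | smul s hs y _ =>
        rw [← mul_smul]
        exact h _ (by rw [pow_succ]; exact Ideal.mul_mem_mul hr hs) y
      | add x _ y _ hx hy => rw [smul_add, hx, hy, add_zero]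
    have h2 : Module.Finite ℂ (N ⧸ N') := by
      apply aux_finite_killed hres
      intro r hr x
      obtain ⟨x, rfl⟩ := Submodule.Quotient.mk_surjective _ x
      rw [← Submodule.Quotient.mk_smul, Submodule.Quotient.mk_eq_zero]
      exact Submodule.smul_mem_smul hr trivial
    have h3 : Module.Finite ℂ (N'.restrictScalars ℂ) := h1
    have h4 : Module.Finite ℂ (N ⧸ N'.restrictScalars ℂ) :=
      Module.Finite.equiv (Submodule.Quotient.restrictScalarsEquiv ℂ N').symm
    exact Module.Finite.of_submodule_quotient (N'.restrictScalars ℂ)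

theorem aux_findim_iff {R : Type*} [CommRing R] [IsLocalRing R] [IsNoetherianRing R] [Algebra ℂ R]
    (hres : Nonempty (IsLocalRing.ResidueField R ≃ₐ[ℂ] ℂ))
    (Q : Type*) [Ring Q] [Algebra R Q] [Module ℂ Q] [IsScalarTower ℂ R Q] [Module.Finite R Q] :
    Module.Finite ℂ Q ↔ ∀ (p : Ideal R) [p.IsPrime], p ≠ IsLocalRing.maximalIdeal R →
      ∃ s, s ∉ p ∧ algebraMap R Q s = 0 := by
  constructor
  · intro hQ p hp hpm
    by_contra! hcon
    apply hpm
    let f : R →ₗ[ℂ] Q := (LinearMap.toSpanSingleton R Q 1).restrictScalars ℂ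
    have h1 : Module.Finite ℂ (R ⧸ LinearMap.ker f) := Module.Finite.equiv f.quotKerEquivRange.symm
    have hle : LinearMap.ker f ≤ LinearMap.ker (Ideal.Quotient.mkₐ ℂ p).toLinearMap := by
      intro r hr
      by_contra hrp
      refine hcon r (fun h => hrp ?_) ?_
      · exact Ideal.Quotient.eq_zero_iff_mem.2 h
      · rw [Algebra.algebraMap_eq_smul_one]; exact hr
    have h2 : Module.Finite ℂ (R ⧸ p) := by
      apply Module.Finite.of_surjective ((LinearMap.ker f).liftQ _ hle)
      intro x
      obtain ⟨x, rfl⟩ := Ideal.Quotient.mk_surjective x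
      exact ⟨Submodule.Quotient.mk x, rfl⟩
    have h3 : IsField (R ⧸ p) := isField_of_isIntegral_of_isField' (Field.toIsField ℂ)
    exact IsLocalRing.eq_maximalIdeal (Ideal.Quotient.maximal_of_isField p h3)
  · intro h
    have hrad : IsLocalRing.maximalIdeal R ≤ (RingHom.ker (algebraMap R Q)).radical := by
      rw [Ideal.radical_eq_sInf]
      refine le_sInf ?_
      rintro p ⟨hle, hp⟩
      by_contra hcon
      obtain ⟨s, hs, hs0⟩ := h p (fun h => hcon h.ge)
      exact hs (hle hs0)
    obtain ⟨n, hn⟩ := Ideal.exists_pow_le_of_le_radical_of_fg hrad (IsNoetherian.noetherian _)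
    apply aux_finite_pow hres n
    intro r hr x
    have : algebraMap R Q r = 0 := hn hr
    rw [Algebra.smul_def, this, zero_mul]

theorem aux_mem_factorIdeal {A : Type*} [Ring A] {N E : Type*} [AddCommGroup N] [AddCommGroup E]
    [Module A N] [Module A E] {f : Module.End A E} :
    f ∈ factorIdeal A N E ↔ f ∈ factorsThroughSet A N E := by
  refine ⟨fun h => ?_, fun h => TwoSidedIdeal.subset_span h⟩
  let J : TwoSidedIdeal (Module.End A E) := TwoSidedIdeal.mk' (factorsThroughSet A N E)
    ⟨0, 0, 0, by simp⟩
    (by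
      rintro _ _ ⟨k, g, h, rfl⟩ ⟨k', g', h', rfl⟩
      let e : (Fin (k + k') → N) ≃ₗ[A] (Fin k → N) × (Fin k' → N) :=
        (LinearEquiv.funCongrLeft A N finSumFinEquiv).trans
          (LinearEquiv.sumArrowLequivProdArrow _ _ A N)
      refine ⟨k + k', e.symm.toLinearMap.comp (g.prod g'), (h.coprod h').comp e.toLinearMap, ?_⟩
      ext x
      simp)
    (by
      rintro _ ⟨k, g, h, rfl⟩
      exact ⟨k, g, -h, by ext; simp⟩)
    (by
      rintro x _ ⟨k, g, h, rfl⟩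
      exact ⟨k, g, x.comp h, rfl⟩)
    (by
      rintro _ y ⟨k, g, h, rfl⟩
      exact ⟨k, g.comp y, h, rfl⟩)
  have hJ : ∀ x, x ∈ J ↔ x ∈ factorsThroughSet A N E := fun x => TwoSidedIdeal.mem_mk' ..
  exact (hJ f).1 ((TwoSidedIdeal.mem_span_iff.1 h) J fun x hx => (hJ x).2 hx)

theorem aux_free_iff {R : Type*} [CommRing R] [IsNoetherianRing R]
    (M : Type*) [AddCommGroup M] [Module R M] [Module.Finite R M] (p : Ideal R) [p.IsPrime] :
    (∃ s, s ∉ p ∧ algebraMap R (Module.End R (R × M)) s ∈ factorIdeal R R (R × M)) ↔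
      Module.Free (Localization p.primeCompl) (LocalizedModule p.primeCompl M) := by
  constructor
  · rintro ⟨s, hs, hmem⟩
    obtain ⟨k, g, h, hgh⟩ := aux_mem_factorIdeal.1 hmem
    let g' : M →ₗ[R] (Fin k → R) := g.comp (LinearMap.inr R R M)
    let h' : (Fin k → R) →ₗ[R] M := (LinearMap.snd R R M).comp h
    have e : h' ∘ₗ g' = s • LinearMap.id := by
      ext x
      have := congrArg Prod.snd (LinearMap.congr_fun hgh (0, x))
      simpa [g', h', Module.algebraMap_end_apply] using this.symm
    let S := p.primeCompl
    have hproj : Module.Projective (Localization S) (LocalizedModule S M) := by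
      let u : (Localization S) := Localization.mk 1 ⟨s, hs⟩
      have : Module.Projective (Localization S) (LocalizedModule S (Fin k → R)) :=
        Module.projective_of_isLocalizedModule (R := R) S (LocalizedModule.mkLinearMap S _)
      refine Module.Projective.of_split (LocalizedModule.map S g')
        (u • LocalizedModule.map S h') ?_
      ext x
      induction x using LocalizedModule.induction_on with
      | _ m t =>
        have := LinearMap.congr_fun e m
        simp only [LinearMap.comp_apply, LinearMap.smul_apply, LinearMap.id_apply] at this
        simp only [LinearMap.comp_apply, LinearMap.smul_apply, LinearMap.id_apply,
          LocalizedModule.map_mk, this, u, LocalizedModule.mk_smul_mk, one_smul]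
        exact LocalizedModule.mk_cancel_common_left ⟨s, hs⟩ t m
    have : Module.Finite (Localization S) (LocalizedModule S M) := inferInstance
    have : IsLocalRing (Localization S) := inferInstanceAs (IsLocalRing (Localization.AtPrime p))
    exact Module.free_of_flat_of_isLocalRing
  · intro hfree
    let S := p.primeCompl
    have hMfp : Module.FinitePresentation R M := Module.finitePresentation_of_finite R M
    obtain ⟨k, π, hπ⟩ := Module.Finite.exists_fin' R M
    let πS := LocalizedModule.map S π
    have hπS : Function.Surjective πS := LocalizedModule.map_surjective S π hπ
    obtain ⟨σ, hσ⟩ := Module.projective_lifting_property πS LinearMap.id hπS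
    obtain ⟨g, s, hg⟩ := Module.FinitePresentation.exists_lift_of_isLocalizedModule S
      (LocalizedModule.mkLinearMap S (Fin k → R))
      ((σ.restrictScalars R).comp (LocalizedModule.mkLinearMap S M))
    have key : (LocalizedModule.mkLinearMap S M).comp (π.comp g) =
        (LocalizedModule.mkLinearMap S M).comp ((s : R) • LinearMap.id) := by
      ext x
      have h1 := congrArg πS (LinearMap.congr_fun hg x)
      have h2 := LinearMap.congr_fun hσ (LocalizedModule.mkLinearMap S M x)
      simp only [LinearMap.comp_apply, LinearMap.smul_apply, LinearMap.id_apply,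
        LinearMap.restrictScalars_apply, map_smul] at h1 h2 ⊢
      have h3 : πS (LocalizedModule.mkLinearMap S (Fin k → R) (g x))
        = LocalizedModule.mkLinearMap S M (π (g x)) := by
        simp [πS, LocalizedModule.mkLinearMap_apply, LocalizedModule.map_mk]
      rw [← h3, h1]
      change πS ((s : R) • _) = _
      rw [LinearMap.map_smul_of_tower, h2]
    obtain ⟨t, ht⟩ := Module.Finite.exists_smul_of_comp_eq_of_isLocalizedModule S _ _ _ key
    refine ⟨(t * s : S), (t * s : S).2, ?_⟩
    let r : R := (t * s : S)
    have a1 : r • (LinearMap.inl R R M ∘ₗ LinearMap.fst R R M) ∈ factorIdeal R R (R × M) := by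
      refine aux_mem_factorIdeal.2 ⟨1,
        (LinearEquiv.funUnique (Fin 1) R R).symm.toLinearMap ∘ₗ LinearMap.fst R R M,
        r • LinearMap.inl R R M ∘ₗ (LinearEquiv.funUnique (Fin 1) R R).toLinearMap, ?_⟩
      ext <;> simp
    have a2 : LinearMap.inr R R M ∘ₗ (t • (π ∘ₗ g)) ∘ₗ LinearMap.snd R R M
        ∈ factorIdeal R R (R × M) :=
      aux_mem_factorIdeal.2 ⟨k, g ∘ₗ LinearMap.snd R R M, LinearMap.inr R R M ∘ₗ (t • π), rfl⟩
    convert (factorIdeal R R (R × M)).add_mem a1 a2 using 1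
    rw [ht]
    ext <;> simp [r, Module.algebraMap_end_apply, mul_smul, Submonoid.smul_def]

theorem aux_quot {R : Type*} [CommRing R] [IsLocalRing R] [IsNoetherianRing R] [Algebra ℂ R]
    (hres : Nonempty (IsLocalRing.ResidueField R ≃ₐ[ℂ] ℂ))
    (A : Type*) [Ring A] [Algebra R A] [Module.Finite R A]
    (Q : Type*) [Ring Q] [Algebra R Q] (π : A →+* Q) (hπ : Function.Surjective π)
    (hcomp : ∀ r, algebraMap R Q r = π (algebraMap R A r)) :
    letI : Module ℂ Q := Module.compHom _ (algebraMap ℂ R)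
    FiniteDimensional ℂ Q ↔ ∀ (p : Ideal R) [p.IsPrime], p ≠ IsLocalRing.maximalIdeal R →
      ∃ s, s ∉ p ∧ π (algebraMap R A s) = 0 := by
  let mod : Module ℂ Q := Module.compHom _ (algebraMap ℂ R)
  have tower : IsScalarTower ℂ R Q := ⟨fun c r x => by
    rw [Algebra.smul_def c r, mul_smul]; rfl⟩
  let φ : A →ₗ[R] Q :=
    { toFun := π
      map_add' := fun x y => map_add _ x y
      map_smul' := fun r x => by
        rw [Algebra.smul_def, map_mul, RingHom.id_apply, Algebra.smul_def, hcomp] }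
  have fin : Module.Finite R Q := Module.Finite.of_surjective φ hπ
  simp_rw [← hcomp]
  exact aux_findim_iff hres Q

/-- for a commutative Noetherian local `ℂ`-algebra `R` with residue field `ℂ`
and a finitely generated `R`-module `M`, the algebra `End_R(R ⊕ M)/[R]` is
finite-dimensional over `ℂ` iff `M_p` is free over `R_p` for every non-maximal prime `p`. -/
theorem stmt7 (R : Type*) [CommRing R] [IsNoetherianRing R] [IsLocalRing R]
    [Algebra ℂ R] (hres : Nonempty (IsLocalRing.ResidueField R ≃ₐ[ℂ] ℂ))
    (M : Type*) [AddCommGroup M] [Module R M] [Module.Finite R M] :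
    letI : Algebra R ((factorIdeal R R (R × M)).ringCon.Quotient) :=
      (factorIdeal R R (R × M)).ringCon.quotientAlgebra'
    letI : Module ℂ ((factorIdeal R R (R × M)).ringCon.Quotient) :=
      Module.compHom _ (algebraMap ℂ R)
    (FiniteDimensional ℂ ((factorIdeal R R (R × M)).ringCon.Quotient) ↔
      ∀ (p : Ideal R) [p.IsPrime], p ≠ IsLocalRing.maximalIdeal R →
        Module.Free (Localization p.primeCompl) (LocalizedModule p.primeCompl M)) := by
  refine (@aux_quot R _ _ _ _ hres (Module.End R (R × M)) _ _ inferInstance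
    ((factorIdeal R R (R × M)).ringCon.Quotient) _
    ((factorIdeal R R (R × M)).ringCon.quotientAlgebra')
    ((factorIdeal R R (R × M)).ringCon.mk') (RingCon.mk'_surjective _) (fun r => rfl)).trans ?_
  refine forall_congr' fun p => forall_congr' fun hp => forall_congr' fun hpm => ?_
  rw [← aux_free_iff M p]
  refine exists_congr fun s => and_congr_right fun _ => ?_
  rw [TwoSidedIdeal.mem_iff]
  exact RingCon.eq _
end

section
/- Let R be a commutative Noetherian local integral domain which is a ℂ-algebra with residue field R/m isomorphic to ℂ, and let M be a nonzero finitely generated torsion-free R-module. If End_R(R ⊕ M)/[R] is finite-dimensional as a ℂ-vector space, then End_R(R ⊕ M)/[M] is finite-dimensional as a ℂ-vector space. -/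
theorem aux_finite {R A B : Type*} [AddCommGroup R] [AddCommGroup A] [AddCommGroup B]
    [Module ℂ R] [Module ℂ A] [Module ℂ B] (f : R →ₗ[ℂ] A) (g : R →ₗ[ℂ] B)
    (hg : Function.Surjective g) (hk : ∀ r, f r = 0 → g r = 0)
    (hA : FiniteDimensional ℂ A) : FiniteDimensional ℂ B := by
  haveI : FiniteDimensional ℂ (R ⧸ LinearMap.ker f) :=
    Module.Finite.equiv f.quotKerEquivRange.symm
  refine Module.Finite.of_surjective ((LinearMap.ker f).liftQ g (fun r hr => hk r hr)) ?_
  intro b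
  obtain ⟨r, rfl⟩ := hg b
  exact ⟨Submodule.Quotient.mk r, rfl⟩

/-- The trace computation. -/
theorem aux_trace {R : Type*} [CommRing R] [IsDomain R] [CharZero R]
    {M : Type*} [AddCommGroup M] [Module R M] [Nontrivial M] [NoZeroSMulDivisors R M]
    (r : R) (hr : r ≠ 0) (k : ℕ) (g : M →ₗ[R] (Fin k → R)) (h : (Fin k → R) →ₗ[R] M)
    (hgh : ∀ m, h (g m) = r • m) :
    ∃ n : ℕ, n ≠ 0 ∧ ∑ i, g (h (Pi.single i 1)) i = r * n := by
  let K := FractionRing R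
  haveI : CharZero K := charZero_of_injective_algebraMap (IsFractionRing.injective R K)
  have hrK : algebraMap R K r ≠ 0 := by simpa using hr
  let P : Matrix (Fin k) (Fin k) R := LinearMap.toMatrix' (g ∘ₗ h)
  have hPP : P * P = r • P := by
    rw [← LinearMap.toMatrix'_comp, ← map_smul]
    congr 1
    ext x i
    simp [hgh]
  have hP : P ≠ 0 := by
    intro h0
    have h1 : g ∘ₗ h = 0 := by simpa [P] using h0
    obtain ⟨m, hm⟩ := exists_ne (0 : M)
    have h2 : h ((g ∘ₗ h) (g m)) = 0 := by rw [h1]; simp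
    simp only [LinearMap.comp_apply, hgh, map_smul, smul_eq_zero, hr, hm, or_self] at h2
  let PK : Matrix (Fin k) (Fin k) K := (algebraMap R K).mapMatrix P
  have hPK : PK * PK = algebraMap R K r • PK := by
    simp only [PK]
    rw [← map_mul, hPP]
    ext i j
    simp
  let Q : Matrix (Fin k) (Fin k) K := (algebraMap R K r)⁻¹ • PK
  have hQ : IsIdempotentElem Q := by
    unfold IsIdempotentElem
    simp only [Q, smul_mul_smul_comm, hPK, smul_smul]
    rw [mul_assoc, inv_mul_cancel₀ hrK, mul_one]
  have hPQ : PK = algebraMap R K r • Q := by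
    simp only [Q, smul_smul, mul_inv_cancel₀ hrK, one_smul]
  have hQ0 : Q ≠ 0 := by
    intro h0
    apply hP
    rw [h0, smul_zero] at hPQ
    ext i j
    have := congrFun (congrFun hPQ i) j
    simpa [PK] using this
  have hQ' : IsIdempotentElem (Matrix.toLin' Q) := by
    unfold IsIdempotentElem
    rw [Module.End.mul_eq_comp, ← Matrix.toLin'_mul, hQ]
  have ht := (LinearMap.IsIdempotentElem.isProj_range _ hQ').trace
  refine ⟨Module.finrank K (LinearMap.range (Matrix.toLin' Q)), ?_, ?_⟩
  · intro h0
    rw [Submodule.finrank_eq_zero, LinearMap.range_eq_bot] at h0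
    exact hQ0 (by simpa using h0)
  · apply IsFractionRing.injective R K
    have e1 : ∑ i, g (h (Pi.single i 1)) i = P.trace := by
      simp [Matrix.trace, P, LinearMap.toMatrix'_apply]
    have e2 : algebraMap R K P.trace = PK.trace := by
      simp [PK, Matrix.trace]
    rw [e1, e2, hPQ, Matrix.trace_smul, ← Matrix.trace_toLin'_eq, ht]
    simp

theorem aux_factor_fintype {A N E ι : Type*} [Ring A] [AddCommGroup N] [AddCommGroup E]
    [Module A N] [Module A E] [Fintype ι] (g : E →ₗ[A] (ι → N)) (h : (ι → N) →ₗ[A] E) :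
    h ∘ₗ g ∈ factorsThroughSet A N E := by
  let e := LinearEquiv.funCongrLeft A N (Fintype.equivFin ι)
  refine ⟨Fintype.card ι, e.symm.toLinearMap ∘ₗ g, h ∘ₗ e.toLinearMap, ?_⟩
  ext x
  simp

theorem aux_factor_ideal {A N E : Type*} [Ring A] [AddCommGroup N] [AddCommGroup E]
    [Module A N] [Module A E] {f : Module.End A E} (hf : f ∈ factorIdeal A N E) :
    f ∈ factorsThroughSet A N E := by
  have h0 : (0 : Module.End A E) ∈ factorsThroughSet A N E := ⟨0, 0, 0, by simp⟩
  have hadd : ∀ {x y : Module.End A E}, x ∈ factorsThroughSet A N E →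
      y ∈ factorsThroughSet A N E → x + y ∈ factorsThroughSet A N E := by
    rintro _ _ ⟨k, g, h, rfl⟩ ⟨k', g', h', rfl⟩
    let e := LinearEquiv.sumArrowLequivProdArrow (Fin k) (Fin k') A N
    have := aux_factor_fintype (e.symm.toLinearMap ∘ₗ g.prod g') (h.coprod h' ∘ₗ e.toLinearMap)
    convert this using 1
    ext x
    simp
  have hneg : ∀ {x : Module.End A E}, x ∈ factorsThroughSet A N E →
      -x ∈ factorsThroughSet A N E := by
    rintro _ ⟨k, g, h, rfl⟩
    exact ⟨k, g, -h, by ext; simp⟩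
  have hl : ∀ {x y : Module.End A E}, y ∈ factorsThroughSet A N E →
      x * y ∈ factorsThroughSet A N E := by
    rintro x _ ⟨k, g, h, rfl⟩
    exact ⟨k, g, x ∘ₗ h, by ext; simp⟩
  have hr : ∀ {x y : Module.End A E}, x ∈ factorsThroughSet A N E →
      x * y ∈ factorsThroughSet A N E := by
    rintro _ y ⟨k, g, h, rfl⟩
    exact ⟨k, g ∘ₗ y, h, by ext; simp⟩
  have hle : factorIdeal A N E ≤ TwoSidedIdeal.mk' (factorsThroughSet A N E) h0 hadd hneg hl hr := by
    refine TwoSidedIdeal.span_le.2 ?_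
    rw [TwoSidedIdeal.coe_mk']
  have := hle hf
  rwa [TwoSidedIdeal.mem_mk'] at this

theorem aux_single {A N E : Type*} [Ring A] [AddCommGroup N] [AddCommGroup E]
    [Module A N] [Module A E] (g : E →ₗ[A] N) (h : N →ₗ[A] E) :
    h ∘ₗ g ∈ factorIdeal A N E := by
  apply TwoSidedIdeal.subset_span
  have := aux_factor_fintype ((LinearEquiv.funUnique Unit A N).symm.toLinearMap ∘ₗ g)
    (h ∘ₗ (LinearEquiv.funUnique Unit A N).toLinearMap)
  convert this using 1
  ext x
  simp

theorem aux_smul_mem {R : Type*} [CommRing R] {N E : Type*} [AddCommGroup N] [AddCommGroup E]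
    [Module R N] [Module R E] {f : Module.End R E} (r : R) (hf : f ∈ factorIdeal R N E) :
    r • f ∈ factorIdeal R N E := by
  have := (factorIdeal R N E).mul_mem_left (algebraMap R _ r) f hf
  rwa [← Algebra.smul_def] at this

theorem aux_eval {R : Type*} [CommRing R] {M : Type*} [AddCommGroup M] [Module R M]
    (φ : M →ₗ[R] R) (m : M) :
    algebraMap R (Module.End R (R × M)) (φ m) ∈ factorIdeal R M (R × M) := by
  have h1 := aux_single (A := R) (LinearMap.toSpanSingleton R M m ∘ₗ LinearMap.fst R R M)
    (LinearMap.inl R R M ∘ₗ φ)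
  have h2 := aux_single (A := R) (φ m • LinearMap.snd R R M) (LinearMap.inr R R M)
  convert TwoSidedIdeal.add_mem _ h1 h2 using 1
  ext <;> simp [mul_comm]

theorem aux_scalar {R : Type*} [CommRing R] {M : Type*} [AddCommGroup M] [Module R M]
    (f : Module.End R (R × M)) :
    algebraMap R (Module.End R (R × M)) (f (1, 0)).1 - f ∈ factorIdeal R M (R × M) := by
  have h1 := aux_single (A := R) (LinearMap.snd R R M ∘ₗ f ∘ₗ LinearMap.inl R R M ∘ₗ
    LinearMap.fst R R M) (LinearMap.inr R R M)
  have h2 := aux_single (A := R) (LinearMap.snd R R M) (f ∘ₗ LinearMap.inr R R M)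
  have h3 := aux_single (A := R) ((f (1, 0)).1 • LinearMap.snd R R M) (LinearMap.inr R R M)
  convert TwoSidedIdeal.sub_mem _ h3 (TwoSidedIdeal.add_mem _ h1 h2) using 1
  have hz : f (0, 0) = 0 := map_zero f
  ext <;> simp [hz]

theorem aux_main {R : Type*} [CommRing R] [IsDomain R] [Algebra ℂ R]
    {M : Type*} [AddCommGroup M] [Module R M] [Nontrivial M] [NoZeroSMulDivisors R M]
    (r : R) (h : algebraMap R (Module.End R (R × M)) r ∈ factorIdeal R R (R × M)) :
    algebraMap R (Module.End R (R × M)) r ∈ factorIdeal R M (R × M) := by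
  by_cases hr : r = 0
  · subst hr
    rw [map_zero]
    exact TwoSidedIdeal.zero_mem _
  haveI : CharZero R := charZero_of_injective_algebraMap (algebraMap ℂ R).injective
  obtain ⟨k, g, h, e⟩ := aux_factor_ideal h
  obtain ⟨n, hn, hs⟩ := aux_trace r hr k (g ∘ₗ LinearMap.inr R R M) (LinearMap.snd R R M ∘ₗ h) (by
    intro m
    have := congrArg Prod.snd (LinearMap.congr_fun e (0, m))
    simpa using this.symm)
  have h1 : algebraMap R (Module.End R (R × M)) (r * n) ∈ factorIdeal R M (R × M) := by
    rw [← hs, map_sum]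
    refine sum_mem fun i _ => ?_
    exact aux_eval (LinearMap.proj i ∘ₗ g ∘ₗ LinearMap.inr R R M) _
  have h2 := aux_smul_mem (algebraMap ℂ R (n : ℂ)⁻¹) h1
  convert h2 using 1
  rw [Algebra.smul_def, ← map_mul]
  congr 1
  have : algebraMap ℂ R (n : ℂ)⁻¹ * (n : R) = 1 := by
    rw [← map_natCast (algebraMap ℂ R) n, ← map_mul, inv_mul_cancel₀ (by exact_mod_cast hn),
      map_one]
  linear_combination (-r) * this

/-- for a commutative Noetherian local domain `R` which is a `ℂ`-algebra with
residue field `ℂ`, and a nonzero finitely generated torsion-free `R`-module `M`, if the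
contraction algebra `End_R(R ⊕ M)/[R]` is finite-dimensional over `ℂ` then so is the fibre
algebra `End_R(R ⊕ M)/[M]`. -/
theorem stmt8 (R : Type*) [CommRing R] [IsDomain R] [IsNoetherianRing R] [IsLocalRing R]
    [Algebra ℂ R] (hres : Nonempty (IsLocalRing.ResidueField R ≃ₐ[ℂ] ℂ))
    (M : Type*) [AddCommGroup M] [Module R M] [Module.Finite R M]
    [Nontrivial M] [NoZeroSMulDivisors R M] :
    letI : Algebra R ((factorIdeal R R (R × M)).ringCon.Quotient) :=
      (factorIdeal R R (R × M)).ringCon.quotientAlgebra'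
    letI : Algebra R ((factorIdeal R M (R × M)).ringCon.Quotient) :=
      (factorIdeal R M (R × M)).ringCon.quotientAlgebra'
    letI : Module ℂ ((factorIdeal R R (R × M)).ringCon.Quotient) :=
      Module.compHom _ (algebraMap ℂ R)
    letI : Module ℂ ((factorIdeal R M (R × M)).ringCon.Quotient) :=
      Module.compHom _ (algebraMap ℂ R)
    FiniteDimensional ℂ ((factorIdeal R R (R × M)).ringCon.Quotient) →
      FiniteDimensional ℂ ((factorIdeal R M (R × M)).ringCon.Quotient) := by
  intro hA
  letI : Algebra R ((factorIdeal R R (R × M)).ringCon.Quotient) :=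
    (factorIdeal R R (R × M)).ringCon.quotientAlgebra'
  letI : Algebra R ((factorIdeal R M (R × M)).ringCon.Quotient) :=
    (factorIdeal R M (R × M)).ringCon.quotientAlgebra'
  letI : Module ℂ ((factorIdeal R R (R × M)).ringCon.Quotient) :=
    Module.compHom _ (algebraMap ℂ R)
  letI : Module ℂ ((factorIdeal R M (R × M)).ringCon.Quotient) :=
    Module.compHom _ (algebraMap ℂ R)
  let f : R →ₗ[ℂ] (factorIdeal R R (R × M)).ringCon.Quotient :=
    { toFun := fun r => algebraMap R _ r
      map_add' := fun x y => map_add _ x y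
      map_smul' := fun c x => by
        have h : algebraMap R (factorIdeal R R (R × M)).ringCon.Quotient (c • x) =
            algebraMap ℂ R c • algebraMap R (factorIdeal R R (R × M)).ringCon.Quotient x := by
          refine congrArg (factorIdeal R R (R × M)).ringCon.toQuotient
            (?_ : algebraMap R (Module.End R (R × M)) (c • x) =
              algebraMap ℂ R c • algebraMap R (Module.End R (R × M)) x)
          rw [Algebra.smul_def, map_mul, ← Algebra.smul_def]
        exact h }
  let g : R →ₗ[ℂ] (factorIdeal R M (R × M)).ringCon.Quotient :=
    { toFun := fun r => algebraMap R _ r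
      map_add' := fun x y => map_add _ x y
      map_smul' := fun c x => by
        have h : algebraMap R (factorIdeal R M (R × M)).ringCon.Quotient (c • x) =
            algebraMap ℂ R c • algebraMap R (factorIdeal R M (R × M)).ringCon.Quotient x := by
          refine congrArg (factorIdeal R M (R × M)).ringCon.toQuotient
            (?_ : algebraMap R (Module.End R (R × M)) (c • x) =
              algebraMap ℂ R c • algebraMap R (Module.End R (R × M)) x)
          rw [Algebra.smul_def, map_mul, ← Algebra.smul_def]
        exact h }
  refine aux_finite f g ?_ ?_ hA
  · intro b
    induction b using Quotient.ind with
    | _ y =>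
      exact ⟨(y (1, 0)).1, Quotient.sound (((factorIdeal R M (R × M)).rel_iff _ _).2
        (aux_scalar y))⟩
  · intro r hr
    have h1 : algebraMap R (Module.End R (R × M)) r ∈ factorIdeal R R (R × M) :=
      (RingCon.eq _).1 hr
    exact (RingCon.eq _).2 (aux_main r h1)
end
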